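/- There exists a universal constant c > 0 such that for all integers r, n, t satisfying r ≥ 2, n ≥ 1 and 1 ≤ t ≤ n, there exists a t-design Y in C_r ≀ S_n with |Y| ≤ (c·r·n)^{c·t}. -/

import Mathlib

/-- The monoid hom `Perm (Fin n) →* MulAut (Fin n → G)`, permuting coordinates. -/
def permMulAut (G : Type*) [CommGroup G] (n : ℕ) :
    Equiv.Perm (Fin n) →* MulAut (Fin n → G) where
  toFun π := MulEquiv.arrowCongr π (MulEquiv.refl G)
  map_one' := by ext f a; rfl
  map_mul' := by intro π σ; ext f a; rfl

/-- The wreath product `G ≀ Sₙ`. -/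
abbrev Wr (G : Type*) [CommGroup G] (n : ℕ) :=
  SemidirectProduct (Fin n → G) (Equiv.Perm (Fin n)) (permMulAut G n)

/-- The natural action of `G ≀ Sₙ` on `G × [n]`. -/
def wAct {G : Type*} [CommGroup G] {n : ℕ} (w : Wr G n) (p : G × Fin n) : G × Fin n :=
  (p.1 * w.left (w.right p.2), w.right p.2)

/-- The `i`-th largest part of a multiset of naturals (0-indexed; `0` beyond the last part). -/
def dparts (s : Multiset ℕ) (i : ℕ) : ℕ := ((s.sort (· ≤ ·)).reverse).getD i 0

/-- `s` is dominated by `t`. -/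
def msDom (s t : Multiset ℕ) : Prop :=
  ∀ k, (((s.sort (· ≤ ·)).reverse).take k).sum ≤ (((t.sort (· ≤ ·)).reverse).take k).sum

/-- `T` is a `(σ,ρ)`-tabloid: the first component assigns to each element of `[n]` a block
(`Sum.inl i` is the block of the `i+1`-st largest part of `σ`, `Sum.inr j` that of `ρ`),
blocks have the prescribed sizes, and the colouring (second component)
is normalised to `1` on the `ρ`-blocks. -/
def IsTabloid (G : Type*) [CommGroup G] (n : ℕ) (σ ρ : Multiset ℕ)
    (T : (Fin n → ℕ ⊕ ℕ) × (Fin n → G)) : Prop :=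
  (∀ i, Nat.card {a : Fin n // T.1 a = Sum.inl i} = dparts σ i) ∧
  (∀ j, Nat.card {a : Fin n // T.1 a = Sum.inr j} = dparts ρ j) ∧
  (∀ a j, T.1 a = Sum.inr j → T.2 a = 1)

/-- The action of the wreath product on (raw) tabloids. -/
def tabAct {G : Type*} [CommGroup G] {n : ℕ} (w : Wr G n)
    (T : (Fin n → ℕ ⊕ ℕ) × (Fin n → G)) : (Fin n → ℕ ⊕ ℕ) × (Fin n → G) :=
  ⟨fun a => T.1 (w.right⁻¹ a),
   fun a => match T.1 (w.right⁻¹ a) with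
     | Sum.inl _ => T.2 (w.right⁻¹ a) * w.left a
     | Sum.inr _ => 1⟩

/-- A subset `Y` of `W` is transitive on `S ⊆ Ω` (w.r.t. an action `act`): there is a
constant `c > 0` such that any `a ∈ S` is mapped to any `b ∈ S` by exactly `c` elements of `Y`. -/
def IsTransitiveOn {W Ω : Type*} (act : W → Ω → Ω) (S : Set Ω) (Y : Set W) : Prop :=
  ∃ c : ℕ, 0 < c ∧ ∀ a ∈ S, ∀ b ∈ S, Nat.card {y : W // y ∈ Y ∧ act y a = b} = c

/-- `Y ⊆ G ≀ Sₙ` is `(σ,ρ)`-transitive. -/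
def DPTransitive (G : Type*) [CommGroup G] (n : ℕ) (σ ρ : Multiset ℕ)
    (Y : Set (Wr G n)) : Prop :=
  IsTransitiveOn tabAct {T | IsTabloid G n σ ρ T} Y

/-- `(σ,ρ) ≽_G (τ,π)` : every `(σ,ρ)`-transitive subset of `G ≀ Sₙ` is `(τ,π)`-transitive. -/
def DPDom (G : Type*) [CommGroup G] (n : ℕ) (σ ρ τ π : Multiset ℕ) : Prop :=
  ∀ Y : Set (Wr G n), DPTransitive G n σ ρ Y → DPTransitive G n τ π Y

/-- The partition obtained by adding `k` to the `r`-th largest part (1-indexed). -/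
def addPart (s : Multiset ℕ) (r k : ℕ) : Multiset ℕ :=
  s.erase (dparts s (r - 1)) + {dparts s (r - 1) + k}

/-- `θ(w)`: the number of fixed points of `w` on `C_r × [n]`, divided by `r`. -/
noncomputable def theta {r n : ℕ} (w : Wr (Multiplicative (ZMod r)) n) : ℕ :=
  Nat.card {p : Multiplicative (ZMod r) × Fin n // wAct w p = p} / r

/-- The Charlier polynomial `C_k^{(a)}(x) = ∑_{j=0}^k (-1)^{k-j} binom(k,j) a^{-j} (x)_j`. -/
noncomputable def charlier (a : ℝ) (k : ℕ) (x : ℝ) : ℝ :=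
  ∑ j ∈ Finset.range (k + 1),
    (-1 : ℝ) ^ (k - j) * (k.choose j : ℝ) * a⁻¹ ^ j * ∏ m ∈ Finset.range j, (x - m)

/-- `Y` is a `t`-design in `C_r ≀ Sₙ`: it is transitive on `t`-tuples of elements of
`C_r × [n]` with pairwise distinct second coordinates. -/
def IsTDesign (r n t : ℕ) (Y : Set (Wr (Multiplicative (ZMod r)) n)) : Prop :=
  IsTransitiveOn (fun w v => fun s => wAct w (v s))
    {v : Fin t → Multiplicative (ZMod r) × Fin n | Function.Injective fun s => (v s).2} Y

/-- `Y` is a `d`-code in `C_r ≀ Sₙ` : `θ(x⁻¹y) ≤ n - d` for all distinct `x, y ∈ Y`. -/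
def IsDCode (r n d : ℕ) (Y : Set (Wr (Multiplicative (ZMod r)) n)) : Prop :=
  ∀ x ∈ Y, ∀ y ∈ Y, x ≠ y → (theta (x⁻¹ * y) : ℤ) ≤ (n : ℤ) - d

namespace SD
section Kernel
open Module

variable {W Ω : Type*} [Group W] [MulAction W Ω]

open Classical in
/-- indicator of `w • a = b` -/
noncomputable def ph (w : W) (q : Ω × Ω) : ℚ := if w • q.1 = q.2 then 1 else 0

lemma ph_left (g x : W) (q : Ω × Ω) : ph (g * x) q = ph x (q.1, g⁻¹ • q.2) := by
  have : (g * x) • q.1 = q.2 ↔ x • q.1 = g⁻¹ • q.2 := by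
    rw [mul_smul, smul_eq_iff_eq_inv_smul g]
  classical exact if_congr this rfl rfl

lemma ph_right (g x : W) (q : Ω × Ω) : ph (x * g) q = ph x (g • q.1, q.2) := by
  have : (x * g) • q.1 = q.2 ↔ x • g • q.1 = q.2 := by
    rw [mul_smul]
  classical exact if_congr this rfl rfl

lemma ph_inv (x : W) (q : Ω × Ω) : ph x⁻¹ q = ph x (q.2, q.1) := by
  have : x⁻¹ • q.1 = q.2 ↔ x • q.2 = q.1 := by
    rw [inv_smul_eq_iff, eq_comm]
  classical exact if_congr this rfl rfl

lemma ph_nonneg (w : W) (q : Ω × Ω) : 0 ≤ ph w q := by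
  unfold ph; split_ifs <;> norm_num

lemma ph_le_one (w : W) (q : Ω × Ω) : ph w q ≤ 1 := by
  unfold ph; split_ifs <;> norm_num

variable (W Ω) in
/-- the span of the matrix coefficients -/
def VV : Submodule ℚ (W → ℚ) :=
  Submodule.span ℚ (Set.range fun q : Ω × Ω => fun w : W => ph w q)

lemma VV_map (e : W → W) (he : ∀ q : Ω × Ω, ∃ q' : Ω × Ω, ∀ x, ph (e x) q = ph x q')
    {v : W → ℚ} (hv : v ∈ VV W Ω) : (fun x => v (e x)) ∈ VV W Ω := by
  have : VV W Ω ≤ (VV W Ω).comap (LinearMap.funLeft ℚ ℚ e) := by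
    rw [VV, Submodule.span_le]
    rintro _ ⟨q, rfl⟩
    obtain ⟨q', hq'⟩ := he q
    refine Submodule.subset_span ⟨q', ?_⟩
    funext x
    simp [LinearMap.funLeft, hq']
  exact this hv

lemma VV_left (g : W) {v : W → ℚ} (hv : v ∈ VV W Ω) : (fun x => v (g * x)) ∈ VV W Ω :=
  VV_map (fun x => g * x) (fun q => ⟨_, fun x => ph_left g x q⟩) hv

lemma VV_right (g : W) {v : W → ℚ} (hv : v ∈ VV W Ω) : (fun x => v (x * g)) ∈ VV W Ω :=
  VV_map (fun x => x * g) (fun q => ⟨_, fun x => ph_right g x q⟩) hv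

lemma VV_inv {v : W → ℚ} (hv : v ∈ VV W Ω) : (fun x => v x⁻¹) ∈ VV W Ω :=
  VV_map (fun x => x⁻¹) (fun q => ⟨_, fun x => ph_inv x q⟩) hv

variable [Fintype W]

lemma exists_repr (V : Submodule ℚ (W → ℚ)) :
    ∃ u ∈ V, ∀ v ∈ V, ∑ x, u x * v x = v 1 := by
  let f : V →ₗ[ℚ] Module.Dual ℚ V :=
    LinearMap.mk₂ ℚ (fun u v : V => ∑ x, u.1 x * v.1 x)
      (by intros; simp [add_mul, Finset.sum_add_distrib])
      (by intros; simp [Finset.mul_sum, mul_assoc])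
      (by intros; simp [mul_add, Finset.sum_add_distrib])
      (by intros; simp [Finset.mul_sum, mul_left_comm])
  have hf : ∀ u v : V, f u v = ∑ x, u.1 x * v.1 x := fun u v => rfl
  have inj : Function.Injective f := by
    rw [injective_iff_map_eq_zero]
    intro u hu
    have h := hf u u
    rw [hu] at h
    have h2 : ∀ x ∈ Finset.univ, u.1 x * u.1 x = 0 := by
      rw [← Finset.sum_eq_zero_iff_of_nonneg (fun x _ => mul_self_nonneg _)]
      simpa using h.symm
    ext x
    simpa using h2 x (Finset.mem_univ _)
  have surj : Function.Surjective f :=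
    (LinearMap.injective_iff_surjective_of_finrank_eq_finrank
      (Subspace.dual_finrank_eq).symm).1 inj
  obtain ⟨u, hu⟩ := surj ((LinearMap.proj (1 : W)).comp V.subtype)
  refine ⟨u.1, u.2, fun v hv => ?_⟩
  have := hf u ⟨v, hv⟩
  rw [hu] at this
  simpa using this.symm

lemma trace_integral {n : Type*} [Fintype n] [DecidableEq n] (M : Matrix n n ℚ) (o : ℕ)
    (ho : 0 < o) (h : M ^ (o + 1) = M) : ∃ z : ℤ, M.trace = z := by
  let K := AlgebraicClosure ℚ
  have hM : (M.map (algebraMap ℚ K)) ^ (o + 1) = M.map (algebraMap ℚ K) := by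
    have := congrArg (fun A => (algebraMap ℚ K).mapMatrix A) h
    simpa [map_pow] using this
  have hint : IsIntegral ℤ ((M.map (algebraMap ℚ K)).trace) := by
    rw [Matrix.trace_eq_sum_roots_charpoly]
    apply IsIntegral.multiset_sum
    intro z hz
    set A := M.map (algebraMap ℚ K)
    have hz' : z ∈ spectrum K A := by
      rw [Matrix.mem_spectrum_iff_isRoot_charpoly]
      exact (Polynomial.mem_roots'.1 hz).2
    have h3 := spectrum.subset_polynomial_aeval A
      (Polynomial.X ^ (o + 1) - Polynomial.X : Polynomial K) ⟨z, hz', rfl⟩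
    have hne : Nontrivial (Matrix n n K) := by
      by_contra hcon
      rw [not_nontrivial_iff_subsingleton] at hcon
      simp [spectrum.of_subsingleton] at hz'
    simp only [map_sub, map_pow, Polynomial.aeval_X, hM, sub_self, spectrum.zero_eq,
      Polynomial.eval_sub, Polynomial.eval_pow, Polynomial.eval_X] at h3
    refine ⟨Polynomial.X ^ (o + 1) - Polynomial.X, ?_, ?_⟩
    · refine Polynomial.monic_X_pow_sub ?_
      rw [Polynomial.degree_X]
      exact_mod_cast Nat.succ_lt_succ ho
    · simpa using h3
  have hint2 : IsIntegral ℤ M.trace := by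
    rw [← isIntegral_algebraMap_iff (A := ℚ) (B := K) (algebraMap ℚ K).injective]
    have : algebraMap ℚ K M.trace = (M.map (algebraMap ℚ K)).trace := by
      simp [Matrix.trace, map_sum]
    rw [this]; exact hint
  obtain ⟨z, hz⟩ := IsIntegrallyClosed.isIntegral_iff.1 hint2
  exact ⟨z, by simpa using hz.symm⟩

variable [Fintype Ω]

theorem exists_kernel :
    ∃ k : W → ℤ, (∀ x, |k x| ≤ (Fintype.card Ω ^ 2 : ℕ)) ∧
      (∃ C : Ω × Ω → ℚ, ∀ x, (k x : ℚ) = ∑ q, C q * ph x q) ∧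
      ∀ q : Ω × Ω, ∑ x, (k x : ℚ) * ph x q = Fintype.card W * ph (1 : W) q := by
  classical
  obtain ⟨u, huV, hu⟩ := exists_repr (VV W Ω)
  have hconv : ∀ v ∈ VV W Ω, ∀ y, ∑ x, u x * v (y * x) = v y := by
    intro v hv y
    simpa using hu _ (VV_left y hv)
  have habs : ∀ y, |u y| ≤ u 1 := by
    intro y
    have h1 := hu u huV
    have h2 := hconv u huV y
    have h3 : ∑ x, u (y * x) * u (y * x) = u 1 := by
      rw [← h1]
      exact Fintype.sum_equiv (Equiv.mulLeft y) _ _ (fun x => rfl)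
    rw [abs_le]
    constructor
    · have : 0 ≤ ∑ x, (u x + u (y * x)) ^ 2 := Finset.sum_nonneg fun _ _ => sq_nonneg _
      have e : ∑ x, (u x + u (y * x)) ^ 2 = u 1 + 2 * u y + u 1 := by
        rw [← h2]
        nth_rewrite 1 [← h1]
        rw [← h3, Finset.mul_sum, ← Finset.sum_add_distrib, ← Finset.sum_add_distrib]
        exact Finset.sum_congr rfl fun x _ => by ring
      linarith
    · have : 0 ≤ ∑ x, (u x - u (y * x)) ^ 2 := Finset.sum_nonneg fun _ _ => sq_nonneg _
      have e : ∑ x, (u x - u (y * x)) ^ 2 = u 1 - 2 * u y + u 1 := by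
        rw [← h2]
        nth_rewrite 1 [← h1]
        rw [← h3, Finset.mul_sum, ← Finset.sum_sub_distrib, ← Finset.sum_add_distrib]
        exact Finset.sum_congr rfl fun x _ => by ring
      linarith
  let M : W → Matrix W W ℚ := fun g => Matrix.of fun x z => u (g * x⁻¹ * z)
  have hMM : ∀ g h, M g * M h = M (h * g) := by
    intro g h
    ext x z
    simp only [Matrix.mul_apply, M, Matrix.of_apply]
    have hv : (fun s => u (h * s⁻¹ * (g * x⁻¹ * z))) ∈ VV W Ω := by
      have a1 := VV_left h huV
      have a2 := VV_right (g * x⁻¹ * z) a1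
      have a3 := VV_inv a2
      simpa [mul_assoc] using a3
    have := hu _ hv
    simp only [inv_one, mul_one] at this
    rw [show h * g * x⁻¹ * z = h * (g * x⁻¹ * z) by group, ← this]
    refine Fintype.sum_equiv (Equiv.mulLeft (g * x⁻¹)) _ _ (fun y => ?_)
    simp only [Equiv.coe_mulLeft]
    congr 2
    group
  have hMpow : ∀ g (m : ℕ), M g ^ (m + 1) = M (g ^ (m + 1)) := by
    intro g m
    induction m with
    | zero => simp
    | succ m ih => rw [pow_succ, ih, hMM, ← pow_succ']
  have htr : ∀ g, (M g).trace = Fintype.card W * u g := by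
    intro g
    simp [Matrix.trace, M, mul_assoc]
  have hint : ∀ g, ∃ z : ℤ, Fintype.card W * u g = z := by
    intro g
    rw [← htr]
    apply trace_integral (M g) (orderOf g) (orderOf_pos g)
    rw [hMpow, pow_succ, pow_orderOf_eq_one, one_mul]
  have hk1 : (Fintype.card W : ℚ) * u 1 = finrank ℚ (VV W Ω) := by
    rw [← htr, ← Matrix.trace_toLin'_eq]
    apply LinearMap.IsProj.trace
    constructor
    · intro v
      have : Matrix.toLin' (M 1) v = ∑ z, v z • fun x => u (x⁻¹ * z) := by
        ext x
        simp [Matrix.toLin'_apply, Matrix.mulVec, dotProduct, M, mul_comm]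
      rw [this]
      refine Submodule.sum_mem _ fun z _ => Submodule.smul_mem _ _ ?_
      exact VV_inv (VV_right z huV)
    · intro v hv
      ext x
      rw [← hconv v hv x]
      simp only [Matrix.toLin'_apply, Matrix.mulVec, dotProduct, M, Matrix.of_apply, one_mul]
      refine Fintype.sum_equiv (Equiv.mulLeft x⁻¹) _ _ (fun y => ?_)
      simp
  have hrank : finrank ℚ (VV W Ω) ≤ Fintype.card Ω ^ 2 := by
    have := finrank_range_le_card (R := ℚ) (fun q : Ω × Ω => fun w : W => ph w q)
    rw [Fintype.card_prod, ← pow_two] at this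
    exact this
  choose k hk using hint
  refine ⟨k, ?_, ?_, ?_⟩
  · intro x
    have : |(k x : ℚ)| ≤ (Fintype.card Ω ^ 2 : ℕ) := by
      rw [← hk, abs_mul, Nat.abs_cast]
      calc _ ≤ (Fintype.card W : ℚ) * u 1 := by gcongr; exact habs x
        _ ≤ _ := by rw [hk1]; exact_mod_cast hrank
    exact_mod_cast this
  · obtain ⟨c, hc⟩ := (Submodule.mem_span_range_iff_exists_fun ℚ).1 huV
    refine ⟨fun q => Fintype.card W * c q, fun x => ?_⟩
    rw [← hk, ← hc]
    simp [Finset.mul_sum, mul_assoc]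
  · intro q
    have := hu (fun w => ph w q) (Submodule.subset_span ⟨q, rfl⟩)
    rw [← this, Finset.mul_sum]
    exact Finset.sum_congr rfl fun x _ => by rw [← hk, mul_assoc]

end Kernel
end SD

namespace SD
section Abs

variable {W : Type*} [Group W] [Fintype W]

/-- integer span of the `ph b`, `b ∈ B` -/
def LL (Ω : Type*) [MulAction W Ω] (B : Finset W) : AddSubgroup (Ω × Ω → ℚ) where
  carrier := {e | ∃ y : W → ℤ, ∀ q, e q = ∑ b ∈ B, (y b : ℚ) * ph b q}
  zero_mem' := ⟨0, by simp⟩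
  add_mem' := by
    rintro e e' ⟨y, hy⟩ ⟨y', hy'⟩
    exact ⟨y + y', fun q => by simp [hy, hy', add_mul, Finset.sum_add_distrib]⟩
  neg_mem' := by
    rintro e ⟨y, hy⟩
    exact ⟨-y, fun q => by simp [hy]⟩

/-- hypotheses on the group action -/
structure Hyp (Ω : Type*) [Fintype Ω] [MulAction W Ω] (B : Finset W) (ν : W → ℤ) (D R : ℕ) :
    Prop where
  hD : 0 < D
  hR : 2 ≤ R
  hB : B.card ≤ R
  hDR : D ≤ R
  hν : ∀ x, |ν x| ≤ R
  hνB : ∀ x, x ∉ B → ν x = 0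
  hN : Fintype.card Ω ^ 2 ≤ R
  hA : ∀ g : W, (ph g : Ω × Ω → ℚ) ∈ LL Ω B
  hνs : ∀ q q' : Ω × Ω, ∑ x, (ν x : ℚ) * (ph x q * ph x q') =
    (D / Fintype.card W : ℚ) * ∑ x : W, ph x q * ph x q'

/-- hypotheses on the kernel -/
structure Ker (Ω : Type*) [Fintype Ω] [MulAction W Ω] (k : W → ℤ) (R : ℕ) : Prop where
  hk : ∀ x, |k x| ≤ R
  hC : ∃ C : Ω × Ω → ℚ, ∀ x, (k x : ℚ) = ∑ q, C q * ph x q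
  hs : ∀ q : Ω × Ω, ∑ x, (k x : ℚ) * ph x q = Fintype.card W * ph (1 : W) q

variable {Ω : Type*} [Fintype Ω] [MulAction W Ω] {B : Finset W} {ν k : W → ℤ} {D R : ℕ}

lemma Hyp.exKer (h : Hyp Ω B ν D R) : ∃ k, Ker (W := W) Ω k R := by
  obtain ⟨k, h1, h2, h3⟩ := exists_kernel (W := W) (Ω := Ω)
  exact ⟨k, fun x => (h1 x).trans (by exact_mod_cast h.hN), h2, h3⟩

lemma Ker.K1 (hk : Ker (W := W) Ω k R) (g : W) (q : Ω × Ω) :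
    ∑ x, (k (x⁻¹ * g) : ℚ) * ph x q = Fintype.card W * ph g q := by
  have h := hk.hs (g⁻¹ • q.2, q.1)
  have e : ph (1 : W) (g⁻¹ • q.2, q.1) = ph g q := by
    have h2 := ph_inv (1 : W) (q.1, g⁻¹ • q.2)
    simp only at h2
    rw [← h2, ← ph_left]; simp
  rw [← e, ← h]
  refine Fintype.sum_equiv ((Equiv.inv W).trans (Equiv.mulRight g)) _ _ fun x => ?_
  have : ph x q = ph (x⁻¹ * g) (g⁻¹ • q.2, q.1) := by
    rw [ph_right, ph_inv]; simp
  rw [this]; rfl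

lemma Ker.K2 (hk : Ker (W := W) Ω k R) (ε : W → ℚ) (hε : ∀ q : Ω × Ω, ∑ g, ε g * ph g q = 0)
    (x : W) : ∑ g, ε g * k (x⁻¹ * g) = 0 := by
  obtain ⟨C, hC⟩ := hk.hC
  simp_rw [hC, Finset.mul_sum]
  rw [Finset.sum_comm]
  refine Finset.sum_eq_zero fun q _ => ?_
  have := hε (q.1, x • q.2)
  calc _ = C q * ∑ g, ε g * ph g (q.1, x • q.2) := by
        rw [Finset.mul_sum]
        refine Finset.sum_congr rfl fun g _ => ?_
        rw [ph_left]; simp; ring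
    _ = 0 := by rw [this, mul_zero]

lemma K3 (h : Hyp Ω B ν D R) (hk : Ker (W := W) Ω k R) (g : W) (q : Ω × Ω) :
    (D : ℚ) * ph g q = ∑ b ∈ B, (ν b : ℚ) * k (b⁻¹ * g) * ph b q := by
  classical
  obtain ⟨C, hC⟩ := hk.hC
  have key : ∀ (m : W → ℚ), ∑ x, m x * k (x⁻¹ * g) * ph x q =
      ∑ p, C p * ∑ x, m x * (ph x (p.2, g • p.1) * ph x q) := by
    intro m
    simp_rw [Finset.mul_sum]
    rw [Finset.sum_comm]
    refine Finset.sum_congr rfl fun x _ => ?_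
    rw [hC, Finset.mul_sum, Finset.sum_mul]
    refine Finset.sum_congr rfl fun p _ => ?_
    rw [ph_right, ph_inv]; ring
  have e1 : ∑ b ∈ B, (ν b : ℚ) * k (b⁻¹ * g) * ph b q =
      ∑ b, (ν b : ℚ) * k (b⁻¹ * g) * ph b q := by
    refine Finset.sum_subset (Finset.subset_univ _) fun x _ hx => ?_
    simp [h.hνB x hx]
  have hW : (Fintype.card W : ℚ) ≠ 0 := by exact_mod_cast Fintype.card_ne_zero
  have e2 := key (fun _ => (D / Fintype.card W : ℚ))
  rw [e1, key]
  simp_rw [h.hνs, Finset.mul_sum, ← Finset.mul_sum] at e2 ⊢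
  rw [← e2]
  have := hk.K1 g q
  simp_rw [mul_assoc, ← Finset.mul_sum]
  rw [this]
  field_simp

/-- spreading lemma -/
lemma spread (h : Hyp Ω B ν D R) (T : Finset W)
    (hT : 2 * (R * T.card) ≤ Fintype.card W) (y : W) :
    ∃ s : W → ℚ, (∀ x ∈ T, s x = 0) ∧ (∀ x, |s x| ≤ R ^ 4 / Fintype.card W) ∧
      ∀ q : Ω × Ω, ph y q = ∑ x, s x * ph x q := by
  classical
  obtain ⟨k, hk⟩ := h.exKer
  have hW : (0 : ℚ) < Fintype.card W := by exact_mod_cast Fintype.card_pos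
  let Gd : Finset W := Finset.univ.filter fun w => ∀ b ∈ B, w * b ∉ T
  have hGd : Fintype.card W ≤ 2 * Gd.card := by
    have h1 : Gdᶜ ⊆ B.biUnion fun b => T.image fun x => x * b⁻¹ := by
      intro w hw
      simp only [Gd, Finset.mem_compl, Finset.mem_filter, Finset.mem_univ, true_and, not_forall,
        not_not] at hw
      obtain ⟨b, hb, hw⟩ := hw
      exact Finset.mem_biUnion.2 ⟨b, hb, Finset.mem_image.2 ⟨_, hw, by simp⟩⟩
    have h2 : Gdᶜ.card ≤ R * T.card := by
      refine (Finset.card_le_card h1).trans ?_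
      refine (Finset.card_biUnion_le_card_mul _ _ T.card fun b _ => Finset.card_image_le).trans ?_
      exact Nat.mul_le_mul_right _ h.hB
    have h3 := Finset.card_add_card_compl Gd
    omega
  have hG0 : (0 : ℚ) < Gd.card := by
    have : 0 < Gd.card := by have := Fintype.card_pos (α := W); omega
    exact_mod_cast this
  have hD : (0 : ℚ) < D := by exact_mod_cast h.hD
  refine ⟨fun x => (∑ b ∈ B, if x * b⁻¹ ∈ Gd then (ν b : ℚ) else 0) * k (x⁻¹ * y) /
    (D * Gd.card), ?_, ?_, ?_⟩
  · intro x hx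
    have : (∑ b ∈ B, if x * b⁻¹ ∈ Gd then (ν b : ℚ) else 0) = 0 := by
      refine Finset.sum_eq_zero fun b hb => if_neg fun hG => ?_
      have := (Finset.mem_filter.1 hG).2 b hb
      simp at this
      exact this hx
    simp [this]
  · intro x
    have a1 : |∑ b ∈ B, if x * b⁻¹ ∈ Gd then (ν b : ℚ) else 0| ≤ R * R := by
      refine (Finset.abs_sum_le_sum_abs _ _).trans ?_
      refine (Finset.sum_le_card_nsmul _ _ (R : ℚ) fun b _ => ?_).trans ?_
      · split_ifs
        · exact_mod_cast h.hν b
        · simp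
      · rw [nsmul_eq_mul]
        gcongr
        exact h.hB
    have a2 : |(k (x⁻¹ * y) : ℚ)| ≤ R := by exact_mod_cast hk.hk _
    rw [abs_div, abs_mul, abs_of_pos (mul_pos hD hG0), div_le_div_iff₀ (mul_pos hD hG0) hW]
    have a3 : (Fintype.card W : ℚ) ≤ 2 * Gd.card := by exact_mod_cast hGd
    have a4 : (1 : ℚ) ≤ D := by exact_mod_cast h.hD
    have a5 : (2 : ℚ) ≤ R := by exact_mod_cast h.hR
    calc _ ≤ (R * R * R) * (2 * Gd.card : ℚ) := by gcongr
      _ ≤ (R * R * R) * (R * (D * Gd.card)) := by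
        have : (Gd.card : ℚ) ≤ D * Gd.card := by nlinarith
        gcongr
      _ = _ := by ring
  · intro q
    have e1 : ∀ w : W, (D : ℚ) * ph y q = ∑ b ∈ B, (ν b : ℚ) * k ((w * b)⁻¹ * y) * ph (w * b) q := by
      intro w
      have := K3 h hk (w⁻¹ * y) (q.1, w⁻¹ • q.2)
      rw [← ph_left] at this
      simp only [mul_inv_cancel_left] at this
      rw [this]
      refine Finset.sum_congr rfl fun b _ => ?_
      rw [ph_left w b q, mul_inv_rev, mul_assoc b⁻¹]
    have e2 : (Gd.card : ℚ) * (D * ph y q) =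
        ∑ w ∈ Gd, ∑ b ∈ B, (ν b : ℚ) * k ((w * b)⁻¹ * y) * ph (w * b) q := by
      rw [← nsmul_eq_mul, ← Finset.sum_const]
      exact Finset.sum_congr rfl fun w _ => e1 w
    rw [Finset.sum_comm] at e2
    have e3 : ∀ b, ∑ w ∈ Gd, (ν b : ℚ) * k ((w * b)⁻¹ * y) * ph (w * b) q =
        ∑ x, (if x * b⁻¹ ∈ Gd then (ν b : ℚ) else 0) * k (x⁻¹ * y) * ph x q := by
      intro b
      rw [← Finset.sum_filter_add_sum_filter_not Finset.univ (fun x => x * b⁻¹ ∈ Gd)]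
      rw [Finset.sum_eq_zero (s := Finset.univ.filter fun x => ¬ (x * b⁻¹ ∈ Gd)), add_zero]
      · refine Finset.sum_bij (fun w _ => w * b) ?_ ?_ ?_ ?_
        · intro w hw; simpa using hw
        · intro w _ w' _ hh; simpa using hh
        · intro x hx; exact ⟨x * b⁻¹, (Finset.mem_filter.1 hx).2, by simp⟩
        · intro w hw; simp [hw]
      · intro x hx
        simp [(Finset.mem_filter.1 hx).2]
    simp_rw [e3] at e2
    rw [Finset.sum_comm] at e2
    have : ph y q = (∑ x, ∑ b ∈ B, (if x * b⁻¹ ∈ Gd then (ν b : ℚ) else 0) * k (x⁻¹ * y) * ph x q)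
        / (D * Gd.card) := by
      rw [← e2]; field_simp
    rw [this, Finset.sum_div]
    refine Finset.sum_congr rfl fun x _ => ?_
    rw [← Finset.sum_mul, ← Finset.sum_mul]
    ring

/-- integer combination lemma -/
lemma intcomb (h : Hyp Ω B ν D R) (f : W → ℚ) (hf0 : ∀ x, 0 ≤ f x) (hf1 : ∀ x, f x ≤ 1)
    (S : Finset W) (hS : S.card ≤ R) (hfS : ∀ x, x ∉ S → f x = 0)
    (e : Ω × Ω → ℚ) (hef : ∀ q, e q = ∑ x, f x * ph x q) (he : e ∈ LL Ω B) :
    ∃ z : W → ℤ, (∀ x, |z x| ≤ R ^ 5) ∧ ∀ q, e q = ∑ b ∈ B, (z b : ℚ) * ph b q := by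
  classical
  obtain ⟨k, hk⟩ := h.exKer
  obtain ⟨y, hy⟩ := he
  have hD : (0 : ℤ) < D := by exact_mod_cast h.hD
  have hDq : (0 : ℚ) < D := by exact_mod_cast h.hD
  let y1 : W → ℤ := fun b => y b / D
  let y2 : W → ℤ := fun b => y b % D
  have hy12 : ∀ b, y b = D * y1 b + y2 b := fun b => (Int.mul_ediv_add_emod _ _).symm
  have hy12q : ∀ b, (y b : ℚ) = D * y1 b + y2 b := fun b => by exact_mod_cast hy12 b
  let P : W → ℤ := fun b => ∑ b' ∈ B, y1 b' * k (b⁻¹ * b')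
  refine ⟨fun b => y2 b + ν b * P b, ?_, ?_⟩
  · intro b
    have hy2a : ∀ b', |(y2 b' : ℚ)| ≤ D := by
      intro b'
      have h1 := Int.emod_nonneg (y b') hD.ne'
      have h2 := Int.emod_lt_of_pos (y b') hD
      have : |y2 b'| ≤ D := by rw [abs_of_nonneg h1]; exact h2.le
      exact_mod_cast this
    have hka : ∀ x, |(k x : ℚ)| ≤ R := fun x => by exact_mod_cast hk.hk x
    have hDP : (D : ℚ) * P b = ∑ g ∈ S, f g * k (b⁻¹ * g) - ∑ b' ∈ B, (y2 b' : ℚ) * k (b⁻¹ * b') := by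
      have := hk.K2 (fun g => (if g ∈ B then (y g : ℚ) else 0) - f g) (by
        intro q
        simp only [sub_mul, Finset.sum_sub_distrib, ← hef, hy, ite_mul, zero_mul,
          Finset.sum_ite_mem, Finset.univ_inter, sub_self]) b
      simp only [sub_mul, Finset.sum_sub_distrib, ite_mul, zero_mul,
          Finset.sum_ite_mem, Finset.univ_inter] at this
      have e2 : ∑ g ∈ S, f g * k (b⁻¹ * g) = ∑ g, f g * (k (b⁻¹ * g) : ℚ) :=
        Finset.sum_subset (Finset.subset_univ _) fun x _ hx => by simp [hfS x hx]
      rw [e2, ← sub_eq_zero.1 this, ← Finset.sum_sub_distrib]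
      simp only [P]
      push_cast
      rw [Finset.mul_sum]
      refine Finset.sum_congr rfl fun b' _ => ?_
      rw [hy12q]; ring
    have b1 : |∑ g ∈ S, f g * (k (b⁻¹ * g) : ℚ)| ≤ R * R := by
      refine (Finset.abs_sum_le_sum_abs _ _).trans ?_
      refine (Finset.sum_le_card_nsmul _ _ (R : ℚ) fun g _ => ?_).trans ?_
      · rw [abs_mul, abs_of_nonneg (hf0 g)]
        calc f g * |(k (b⁻¹ * g) : ℚ)| ≤ 1 * R := by
              gcongr
              · exact hf1 g
              · exact hka _
          _ = R := one_mul _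
      · rw [nsmul_eq_mul]; gcongr
    have b2 : |∑ b' ∈ B, (y2 b' : ℚ) * k (b⁻¹ * b')| ≤ R * (D * R) := by
      refine (Finset.abs_sum_le_sum_abs _ _).trans ?_
      refine (Finset.sum_le_card_nsmul _ _ (D * R : ℚ) fun g _ => ?_).trans ?_
      · rw [abs_mul]
        gcongr
        · exact hy2a g
        · exact hka _
      · rw [nsmul_eq_mul]; gcongr; exact h.hB
    have hD1 : (1 : ℚ) ≤ D := by exact_mod_cast h.hD
    have hPb : |(P b : ℚ)| ≤ 2 * (R * R) := by
      have : (D : ℚ) * |(P b : ℚ)| ≤ D * (2 * (R * R)) := by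
        calc (D : ℚ) * |(P b : ℚ)| = |(D : ℚ) * P b| := by rw [abs_mul, Nat.abs_cast]
          _ ≤ R * R + R * (D * R) := by
            rw [hDP]; exact (abs_sub _ _).trans (add_le_add b1 b2)
          _ ≤ _ := by nlinarith [mul_self_nonneg (R : ℚ)]
      exact le_of_mul_le_mul_left this hDq
    have hνb : |(ν b : ℚ)| ≤ R := by exact_mod_cast h.hν b
    have hR : (2 : ℚ) ≤ R := by exact_mod_cast h.hR
    have hDR : (D : ℚ) ≤ R := by exact_mod_cast h.hDR
    have : |((y2 b + ν b * P b : ℤ) : ℚ)| ≤ (R : ℚ) ^ 5 := by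
      push_cast
      calc _ ≤ |(y2 b : ℚ)| + |(ν b : ℚ)| * |(P b : ℚ)| := by
            rw [← abs_mul]; exact abs_add_le _ _
        _ ≤ R + R * (2 * (R * R)) := by
          gcongr
          exact (hy2a b).trans hDR
        _ ≤ R ^ 5 := by
          have h4 : (4 : ℚ) ≤ R * R := by nlinarith
          have h16 : (4 : ℚ) * (R * R) ≤ (R * R) * (R * R) := by nlinarith
          have : (1 + 2 * (R * R) : ℚ) ≤ (R * R) * (R * R) := by linarith
          calc (R + R * (2 * (R * R)) : ℚ) = R * (1 + 2 * (R * R)) := by ring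
            _ ≤ R * ((R * R) * (R * R)) := by gcongr
            _ = R ^ 5 := by ring
    exact_mod_cast this
  · intro q
    have hsum : ∑ b ∈ B, (ν b : ℚ) * P b * ph b q = ∑ b' ∈ B, (y1 b' : ℚ) * (D * ph b' q) := by
      simp_rw [K3 h hk, Finset.mul_sum]
      rw [Finset.sum_comm]
      refine Finset.sum_congr rfl fun b _ => ?_
      simp only [P]
      push_cast
      rw [Finset.mul_sum, Finset.sum_mul]
      refine Finset.sum_congr rfl fun b' _ => ?_
      ring
    push_cast
    simp_rw [add_mul, Finset.sum_add_distrib]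
    rw [hsum, hy, ← Finset.sum_add_distrib]
    refine Finset.sum_congr rfl fun b' _ => ?_
    rw [hy12q]; ring

open Classical in
/-- rounding lemma -/
lemma rounding (F : W → ℚ) (h0 : ∀ x, 0 ≤ F x) (h1 : ∀ x, F x ≤ 1) :
    ∃ F' : W → ℚ, (∀ x, 0 ≤ F' x) ∧ (∀ x, F' x ≤ 1) ∧ (∀ x, F x = 0 → F' x = 0) ∧
      (∀ q : Ω × Ω, ∑ x, F' x * ph x q = ∑ x, F x * ph x q) ∧
      (Finset.univ.filter fun x => 0 < F' x ∧ F' x < 1).card ≤ Fintype.card Ω ^ 2 := by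
  induction hm : (Finset.univ.filter fun x => 0 < F x ∧ F x < 1).card using
    Nat.strong_induction_on generalizing F with
  | _ m ih =>
  set S := (Finset.univ.filter fun x => 0 < F x ∧ F x < 1) with hS
  by_cases hle : S.card ≤ Fintype.card Ω ^ 2
  · exact ⟨F, h0, h1, fun _ h => h, fun _ => rfl, hle⟩
  have hdep : ¬ LinearIndependent ℚ (fun x : S => (ph (x : W) : Ω × Ω → ℚ)) := by
    intro hli
    have := hli.fintype_card_le_finrank
    simp only [Fintype.card_coe, Module.finrank_fintype_fun_eq_card, Fintype.card_prod] at this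
    rw [pow_two] at hle
    exact hle this
  rw [Fintype.not_linearIndependent_iff] at hdep
  obtain ⟨c, hc, ⟨x1, hx1⟩⟩ := hdep
  let ε : W → ℚ := fun x => if hx : x ∈ S then c ⟨x, hx⟩ else 0
  have hε : ∀ q : Ω × Ω, ∑ x, ε x * ph x q = 0 := by
    intro q
    have := congrFun hc q
    simp only [Finset.sum_apply, Pi.smul_apply, smul_eq_mul, Pi.zero_apply] at this
    rw [← this, ← Finset.sum_subset (Finset.subset_univ S), ← Finset.sum_coe_sort S]
    · refine Finset.sum_congr rfl fun x _ => ?_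
      simp [ε]
    · intro x _ hx; simp [ε, hx]
  let τ : W → ℚ := fun x => if 0 < ε x then (1 - F x) / ε x else -F x / ε x
  let S' := S.filter fun x => ε x ≠ 0
  have hS' : S'.Nonempty := ⟨x1.1, by simp [S', ε, hx1]⟩
  obtain ⟨x0, hx0, hmin⟩ := Finset.exists_min_image S' τ hS'
  have memS : ∀ x, x ∈ S ↔ 0 < F x ∧ F x < 1 := fun x => by simp [S]
  have hx0S := (Finset.mem_filter.1 hx0)
  have hτ : 0 < τ x0 := by
    have := (memS _).1 hx0S.1
    simp only [τ]
    split_ifs with hpos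
    · exact div_pos (by linarith) hpos
    · exact div_pos_of_neg_of_neg (by linarith) (lt_of_le_of_ne (not_lt.1 hpos) hx0S.2)
  let F2 : W → ℚ := fun x => F x + τ x0 * ε x
  have hin : ∀ x, 0 ≤ F2 x ∧ F2 x ≤ 1 := by
    intro x
    by_cases hx : x ∈ S'
    · have hxS := Finset.mem_filter.1 hx
      have hF := (memS _).1 hxS.1
      have hm := hmin x hx
      by_cases hpos : 0 < ε x
      · have e1 : τ x = (1 - F x) / ε x := if_pos hpos
        rw [e1, le_div_iff₀ hpos] at hm
        have := mul_pos hτ hpos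
        simp only [F2]
        constructor <;> linarith
      · have e1 : τ x = -F x / ε x := if_neg hpos
        have hneg : ε x < 0 := lt_of_le_of_ne (not_lt.1 hpos) hxS.2
        rw [e1, le_div_iff_of_neg hneg] at hm
        have := mul_neg_of_pos_of_neg hτ hneg
        simp only [F2]
        constructor <;> linarith
    · have : ε x = 0 := by
        by_contra hne
        refine hx (Finset.mem_filter.2 ⟨?_, hne⟩)
        by_contra hxS
        exact hne (by simp [ε, hxS])
      simp only [F2, this, mul_zero, add_zero]
      exact ⟨h0 x, h1 x⟩
  have hout : ∀ x, x ∉ S → F2 x = F x := by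
    intro x hx; simp [F2, ε, hx]
  have hx0v : F2 x0 = 0 ∨ F2 x0 = 1 := by
    simp only [F2, τ]
    split_ifs
    · right; field_simp [hx0S.2]; ring
    · left; field_simp [hx0S.2]; ring
  have hsub : (Finset.univ.filter fun x => 0 < F2 x ∧ F2 x < 1) ⊂ S := by
    rw [Finset.ssubset_iff_of_subset]
    · refine ⟨x0, hx0S.1, ?_⟩
      rcases hx0v with h | h <;> simp [h]
    · intro x hx
      by_contra hxS
      have := (Finset.mem_filter.1 hx).2
      rw [hout x hxS] at this
      exact hxS ((memS x).2 this)
  obtain ⟨F', a1, a2, a3, a4, a5⟩ := ih _ (hm ▸ Finset.card_lt_card hsub) F2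
    (fun x => (hin x).1) (fun x => (hin x).2) rfl
  refine ⟨F', a1, a2, ?_, ?_, a5⟩
  · intro x hx
    apply a3
    rw [hout x, hx]
    simp [memS, hx]
  · intro q
    rw [a4]
    simp only [F2, add_mul, Finset.sum_add_distrib, mul_assoc, ← Finset.mul_sum, hε, mul_zero,
      add_zero]

end Abs
end SD

namespace SD
section Trade

variable {W : Type*} [Group W] [Fintype W]

lemma greedy (b : W) (Fb : Finset W) (hb : b ∈ Fb) (m : ℕ)
    (hm : m * (2 * Fb.card) ≤ Fintype.card W) :
    ∃ G : Finset W, G.card = m ∧ ∀ x ∈ G, ∀ y ∈ G, x ≠ y → b * x⁻¹ * y ∉ Fb := by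
  classical
  induction m with
  | zero => exact ⟨∅, by simp⟩
  | succ m ih =>
    have hF : 0 < Fb.card := Finset.card_pos.2 ⟨b, hb⟩
    have hlt : m * (2 * Fb.card) < Fintype.card W := by
      rw [Nat.succ_mul] at hm; omega
    obtain ⟨G, hG, hGp⟩ := ih hlt.le
    let bad : Finset W := G.biUnion fun x =>
      (Fb.image fun f => x * b⁻¹ * f) ∪ (Fb.image fun f => x * f⁻¹ * b)
    have hbad : bad.card < Fintype.card W := by
      refine lt_of_le_of_lt (Finset.card_biUnion_le_card_mul _ _ (2 * Fb.card) fun x _ => ?_)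
        (hG ▸ hlt)
      refine (Finset.card_union_le _ _).trans ?_
      have h1 : (Fb.image fun f => x * b⁻¹ * f).card ≤ Fb.card := Finset.card_image_le
      have h2 : (Fb.image fun f => x * f⁻¹ * b).card ≤ Fb.card := Finset.card_image_le
      omega
    obtain ⟨y, hy⟩ : ∃ y, y ∉ bad := by
      by_contra hcon
      push Not at hcon
      have : bad = Finset.univ := Finset.eq_univ_iff_forall.2 hcon
      rw [this, Finset.card_univ] at hbad
      exact lt_irrefl _ hbad
    have hy1 : ∀ x ∈ G, b * x⁻¹ * y ∉ Fb := by
      intro x hx hf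
      refine hy (Finset.mem_biUnion.2 ⟨x, hx, Finset.mem_union_left _ (Finset.mem_image.2
        ⟨_, hf, by group⟩)⟩)
    have hy2 : ∀ x ∈ G, b * y⁻¹ * x ∉ Fb := by
      intro x hx hf
      refine hy (Finset.mem_biUnion.2 ⟨x, hx, Finset.mem_union_right _ (Finset.mem_image.2
        ⟨_, hf, by group⟩)⟩)
    have hyG : y ∉ G := by
      intro hyG
      have := hy1 y hyG
      simp at this
      exact this hb
    refine ⟨insert y G, by rw [Finset.card_insert_of_notMem hyG, hG], ?_⟩
    intro x hx z hz hxz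
    rcases Finset.mem_insert.1 hx with rfl | hx2
    · rcases Finset.mem_insert.1 hz with rfl | hz2
      · exact absurd rfl hxz
      · exact hy2 z hz2
    · rcases Finset.mem_insert.1 hz with rfl | hz2
      · exact hy1 x hx2
      · exact hGp x hx2 z hz2 hxz

variable {Ω : Type*} [Fintype Ω] [MulAction W Ω]

/-- a trade expressing `ph b` -/
structure IsTrade (Ω : Type*) [Fintype Ω] [MulAction W Ω] (b : W) (g : ℕ) (P N : Finset W) :
    Prop where
  disj : Disjoint P N
  cP : P.card ≤ g
  cN : N.card ≤ g
  eq : ∀ q : Ω × Ω, ∑ x ∈ P, ph x q = ph b q + ∑ x ∈ N, ph x q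

lemma exists_trade (b : W) (Fb : Finset W) (hb : b ∈ Fb) (g : ℕ)
    (hg : (g + 1) ^ (Fintype.card Ω ^ 2) < 2 ^ g)
    (hm : g * (2 * Fb.card) ≤ Fintype.card W) :
    ∃ P N : Finset W, IsTrade Ω b g P N ∧ Disjoint P Fb ∧ Disjoint N Fb := by
  classical
  obtain ⟨G, hG, hGp⟩ := greedy b Fb hb g hm
  let cnt : Finset W → (Ω × Ω → ℕ) := fun X q => (X.filter fun x => x • q.1 = q.2).card
  have hcnt : ∀ X q, ∑ x ∈ X, ph x q = (cnt X q : ℚ) := by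
    intro X q
    simp only [cnt, ph, Finset.sum_ite, Finset.sum_const,
      nsmul_eq_mul, mul_one, mul_zero, add_zero]
  obtain ⟨X, hX, X', hX', hne, heq⟩ := Finset.exists_ne_map_eq_of_card_lt_of_maps_to
    (s := G.powerset) (t := Fintype.piFinset fun _ : Ω × Ω => Finset.range (g + 1)) (f := cnt)
    (by
      rw [Fintype.card_piFinset, Finset.card_powerset, hG]
      simpa [← pow_two] using hg)
    (by
      intro X hX
      simp only [Finset.coe_powerset, Set.mem_preimage, Set.mem_powerset_iff, Finset.coe_subset,
        Finset.mem_coe, Fintype.mem_piFinset, Finset.mem_range] at hX ⊢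
      intro q
      have := Finset.card_filter_le X (fun x => x • q.1 = q.2)
      have := Finset.card_le_card hX
      simp only [cnt]
      omega)
  rw [Finset.mem_powerset] at hX hX'
  have main : ∀ X X' : Finset W, X ⊆ G → X' ⊆ G → cnt X = cnt X' → (X \ X').Nonempty →
      ∃ P N : Finset W, IsTrade Ω b g P N ∧ Disjoint P Fb ∧ Disjoint N Fb := by
    intro X X' hX hX' heq ⟨x, hx⟩
    have hxG := hX (Finset.mem_sdiff.1 hx).1
    have hdis : Disjoint (X' \ X) ((X \ X').erase x) :=
      (Finset.disjoint_left.2 fun y hy hy' =>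
        (Finset.mem_sdiff.1 hy).2 (Finset.mem_sdiff.1 (Finset.mem_of_mem_erase hy')).1)
    have inj : Function.Injective (fun y => b * x⁻¹ * y) := mul_right_injective _
    have cg : ∀ A : Finset W, A ⊆ G → (A.image fun y => b * x⁻¹ * y).card ≤ g := fun A hA =>
      Finset.card_image_le.trans (hG ▸ Finset.card_le_card hA)
    have av : ∀ A : Finset W, A ⊆ G → x ∉ A → Disjoint (A.image fun y => b * x⁻¹ * y) Fb := by
      intro A hA hxA
      rw [Finset.disjoint_left]
      intro y hy
      obtain ⟨z, hz, rfl⟩ := Finset.mem_image.1 hy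
      exact hGp x hxG z (hA hz) (fun h => hxA (h ▸ hz))
    have s1 : X' \ X ⊆ G := Finset.sdiff_subset.trans hX'
    have s2 : (X \ X').erase x ⊆ G := (Finset.erase_subset _ _).trans (Finset.sdiff_subset.trans hX)
    refine ⟨(X' \ X).image fun y => b * x⁻¹ * y, ((X \ X').erase x).image fun y => b * x⁻¹ * y,
      ⟨?_, cg _ s1, cg _ s2, ?_⟩, av _ s1 ?_, av _ s2 (Finset.notMem_erase _ _)⟩
    · exact (Finset.disjoint_image inj).2 hdis
    · intro q
      rw [Finset.sum_image (fun _ _ _ _ h => inj h), Finset.sum_image (fun _ _ _ _ h => inj h)]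
      simp_rw [ph_left (b * x⁻¹)]
      have e : ph b q = ph x (q.1, (b * x⁻¹)⁻¹ • q.2) := by rw [← ph_left]; simp
      rw [e]
      generalize (q.1, (b * x⁻¹)⁻¹ • q.2) = p
      rw [Finset.add_sum_erase _ (fun y => ph y p) hx]
      have h1 := Finset.sum_sdiff_sub_sum_sdiff (s₁ := X) (s₂ := X') (f := fun y => ph y p)
      rw [hcnt X', hcnt X, heq, sub_self, sub_eq_zero] at h1
      exact h1
    · exact fun h => (Finset.mem_sdiff.1 h).2 (Finset.mem_sdiff.1 hx).1
  by_cases hn : (X \ X').Nonempty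
  · exact main X X' hX hX' heq hn
  · refine main X' X hX' hX heq.symm ?_
    rw [Finset.not_nonempty_iff_eq_empty, Finset.sdiff_eq_empty_iff_subset] at hn
    rw [Finset.nonempty_iff_ne_empty, Ne, Finset.sdiff_eq_empty_iff_subset]
    exact fun h => hne (Finset.Subset.antisymm hn h)

open Classical in
lemma exists_trades {ι : Type*} (β : ι → W) (g K : ℕ)
    (hg : (g + 1) ^ (Fintype.card Ω ^ 2) < 2 ^ g)
    (hK : g * (2 * (1 + K * (2 * g))) ≤ Fintype.card W) (s : Finset ι) (hs : s.card ≤ K) :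
    ∃ P N : ι → Finset W, (∀ i ∈ s, IsTrade Ω (β i) g (P i) (N i)) ∧
      ∀ i ∈ s, ∀ j ∈ s, i ≠ j → Disjoint (P i ∪ N i) (P j ∪ N j) := by
  induction s using Finset.induction_on with
  | empty => exact ⟨fun _ => ∅, fun _ => ∅, by simp⟩
  | insert a s ha ih =>
    rw [Finset.card_insert_of_notMem ha] at hs
    obtain ⟨P, N, h1, h2⟩ := ih (by omega)
    let U := s.biUnion fun i => P i ∪ N i
    have hU : U.card ≤ K * (2 * g) := by
      refine (Finset.card_biUnion_le_card_mul _ _ (2 * g) fun i hi => ?_).trans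
        (Nat.mul_le_mul_right _ (by omega))
      refine (Finset.card_union_le _ _).trans ?_
      have := (h1 i hi).cP
      have := (h1 i hi).cN
      omega
    obtain ⟨P', N', h3, h4, h5⟩ := exists_trade (Ω := Ω) (β a) (insert (β a) U)
      (Finset.mem_insert_self _ _) g hg (le_trans (Nat.mul_le_mul_left _ (Nat.mul_le_mul_left _
        ((Finset.card_insert_le _ _).trans (by omega)))) hK)
    have hd : ∀ i ∈ s, Disjoint (P' ∪ N') (P i ∪ N i) := by
      intro i hi
      have hsub : P i ∪ N i ⊆ insert (β a) U :=
        (Finset.subset_biUnion_of_mem (fun i => P i ∪ N i) hi).trans (Finset.subset_insert _ _)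
      exact Finset.disjoint_of_subset_right hsub (Finset.disjoint_union_left.2 ⟨h4, h5⟩)
    have hne : ∀ i ∈ s, i ≠ a := fun i hi h => ha (h ▸ hi)
    refine ⟨Function.update P a P', Function.update N a N', ?_, ?_⟩
    · intro i hi
      rcases Finset.mem_insert.1 hi with rfl | hi
      · simpa using h3
      · simpa [hne i hi] using h1 i hi
    · intro i hi j hj hij
      rcases Finset.mem_insert.1 hi with rfl | hi2
      · rcases Finset.mem_insert.1 hj with rfl | hj2
        · exact absurd rfl hij
        · simpa [hne j hj2] using hd j hj2
      · rcases Finset.mem_insert.1 hj with rfl | hj2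
        · simpa [hne i hi2] using (hd i hi2).symm
        · simpa [hne i hi2, hne j hj2] using h2 i hi2 j hj2 hij

end Trade
end SD

namespace SD
section Main

variable {W : Type*} [Group W] [Fintype W]
variable {Ω : Type*} [Fintype Ω] [MulAction W Ω] {B : Finset W} {ν : W → ℤ} {D R : ℕ}

lemma pow_bound (R N2 : ℕ) (hR : 2 ≤ R) (hN : N2 ≤ R) : (R ^ 4 + 1) ^ N2 < 2 ^ (R ^ 4) := by
  have h1 : R + 1 ≤ 2 ^ R := Nat.lt_two_pow_self
  have h2 : R ^ 4 + 1 < (R + 1) ^ 4 := by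
    have : (R + 1) ^ 4 = R ^ 4 + 4 * R ^ 3 + 6 * R ^ 2 + 4 * R + 1 := by ring
    have := pow_pos (show 0 < R by omega) 3
    omega
  have h3 : (R + 1) ^ 4 ≤ 2 ^ (R ^ 3) := by
    calc (R + 1) ^ 4 ≤ (2 ^ R) ^ 4 := Nat.pow_le_pow_left h1 4
      _ = 2 ^ (R * 4) := by rw [pow_mul]
      _ ≤ 2 ^ (R ^ 3) := by
        apply Nat.pow_le_pow_right (by norm_num)
        have : 4 ≤ R * R := Nat.mul_le_mul hR hR
        calc R * 4 ≤ R * (R * R) := Nat.mul_le_mul_left _ this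
          _ = R ^ 3 := by ring
  calc (R ^ 4 + 1) ^ N2 ≤ (R ^ 4 + 1) ^ R := Nat.pow_le_pow_right (by omega) hN
    _ < (2 ^ (R ^ 3)) ^ R := Nat.pow_lt_pow_left (lt_of_lt_of_le h2 h3) (by omega)
    _ = 2 ^ (R ^ 4) := by rw [← pow_mul]; congr 1

lemma abs_sum_le_card_mul {α : Type*} (s : Finset α) (f : α → ℚ) (n : ℕ) (c : ℚ) (hc : 0 ≤ c)
    (hs : s.card ≤ n) (hf : ∀ x ∈ s, |f x| ≤ c) : |∑ x ∈ s, f x| ≤ n * c := by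
  refine (Finset.abs_sum_le_sum_abs _ _).trans ?_
  refine (Finset.sum_le_card_nsmul _ _ c hf).trans ?_
  rw [nsmul_eq_mul]; gcongr

theorem main_abstract (h : Hyp Ω B ν D R) (hW : R ^ 40 ≤ Fintype.card W) :
    ∃ (Y : Finset W) (M : ℕ), 0 < M ∧ M ≤ R ^ 18 ∧
      ∀ q : Ω × Ω, ∑ y ∈ Y, ph y q = (M / Fintype.card W : ℚ) * ∑ x : W, ph x q := by
  classical
  have hR := h.hR
  have hR1 : 1 ≤ R := by omega
  have pp : ∀ a b : ℕ, a ≤ b → R ^ a ≤ R ^ b := fun a b hab => Nat.pow_le_pow_right hR1 hab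
  have p2' : ∀ a b : ℕ, a + 1 = b → 2 * R ^ a ≤ R ^ b := fun a b hab => by
    subst hab
    rw [pow_succ, mul_comm (R ^ a)]; exact Nat.mul_le_mul_right _ hR
  let s : Finset (W × ℕ) := B ×ˢ Finset.range (2 * R ^ 5)
  have hs : s.card ≤ 2 * R ^ 6 := by
    rw [Finset.card_product, Finset.card_range]
    calc _ ≤ R * (2 * R ^ 5) := Nat.mul_le_mul_right _ h.hB
      _ = _ := by ring
  obtain ⟨P, N, hPN, hdis⟩ := exists_trades (Ω := Ω) (Prod.fst : W × ℕ → W) (R ^ 4) (2 * R ^ 6)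
    (pow_bound R _ hR h.hN) (by
      refine le_trans ?_ hW
      have e : R ^ 4 * (2 * (1 + 2 * R ^ 6 * (2 * R ^ 4))) = 2 * R ^ 4 + 8 * R ^ 14 := by ring
      rw [e]
      have := p2' 4 5 rfl; have := p2' 14 15 rfl; have := p2' 15 16 rfl; have := p2' 16 17 rfl; have := pp 5 17 (by norm_num)
      have := p2' 17 18 rfl; have := pp 18 40 (by norm_num)
      omega) s hs
  let T : Finset W := s.biUnion fun i => P i ∪ N i
  have hT : T.card ≤ R ^ 12 := by
    refine (Finset.card_biUnion_le_card_mul _ _ (2 * R ^ 4) fun i hi => ?_).trans ?_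
    · refine (Finset.card_union_le _ _).trans ?_
      have := (hPN i hi).cP
      have := (hPN i hi).cN
      omega
    · refine (Nat.mul_le_mul_right _ hs).trans ?_
      have e : 2 * R ^ 6 * (2 * R ^ 4) = 4 * R ^ 10 := by ring
      have := p2' 10 11 rfl; have := p2' 11 12 rfl
      omega
  have hTW : 2 * (R * T.card) ≤ Fintype.card W := by
    calc 2 * (R * T.card) ≤ 2 * (R * R ^ 12) := by gcongr
      _ = 2 * R ^ 13 := by ring
      _ ≤ R ^ 14 := p2' 13 14 rfl
      _ ≤ _ := (pp 14 40 (by norm_num)).trans hW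
  choose sp sp0 spb spe using spread h T hTW
  have hWp : (0 : ℚ) < Fintype.card W := by exact_mod_cast Fintype.card_pos
  set c : ℚ := (Fintype.card W : ℚ) with hc
  let M : ℕ := D * R ^ 17
  have hM1 : R ^ 17 ≤ M := Nat.le_mul_of_pos_left _ h.hD
  have hM2 : M ≤ R ^ 18 := by
    calc M ≤ R * R ^ 17 := Nat.mul_le_mul_right _ h.hDR
      _ = _ := by ring
  have hM0 : 0 < M := lt_of_lt_of_le (pow_pos (by omega) _) hM1
  let m : ℚ := M / c
  have hm0 : 0 ≤ m := by positivity
  let A1 : W → ℚ := fun x => ∑ y ∈ T, m * sp y x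
  let A2 : W → ℚ := fun x => ∑ i ∈ s, ∑ y ∈ N i, sp y x
  let A3 : W → ℚ := fun x => ∑ b ∈ B, (R ^ 5 : ℚ) * sp b x
  let F : W → ℚ := fun x => (if x ∈ T then 0 else m) + A1 x - A2 x - A3 x
  have hδ : (0 : ℚ) ≤ R ^ 4 / c := by positivity
  have hA1 : ∀ x, |A1 x| ≤ m / 2 := by
    intro x
    refine (abs_sum_le_card_mul T _ (R ^ 12) (m * (R ^ 4 / c)) (by positivity) hT ?_).trans ?_
    · intro y _
      rw [abs_mul, abs_of_nonneg hm0]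
      gcongr
      exact spb y x
    · push_cast
      have h1 : (2 * R ^ 16 : ℚ) ≤ c := by
        have : 2 * R ^ 16 ≤ Fintype.card W := (p2' 16 17 rfl).trans ((pp 17 40 (by norm_num)).trans hW)
        rw [hc]
        exact_mod_cast this
      have h2 : (R ^ 16 / c : ℚ) ≤ 1 / 2 := by rw [div_le_iff₀ hWp]; linarith
      calc (R : ℚ) ^ 12 * (m * (R ^ 4 / c)) = m * (R ^ 16 / c) := by ring
        _ ≤ m * (1 / 2) := by gcongr
        _ = m / 2 := by ring
  have hA23 : ∀ x, |A2 x| + |A3 x| ≤ m / 2 := by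
    intro x
    have a2 : |A2 x| ≤ ((2 * R ^ 6 : ℕ) : ℚ) * (((R ^ 4 : ℕ) : ℚ) * (R ^ 4 / c)) := by
      refine abs_sum_le_card_mul s _ _ _ (by positivity) hs ?_
      intro i hi
      refine abs_sum_le_card_mul (N i) _ _ _ hδ (hPN i hi).cN ?_
      intro y _
      exact spb y x
    have a3 : |A3 x| ≤ (R : ℚ) * (R ^ 5 * (R ^ 4 / c)) := by
      refine abs_sum_le_card_mul B _ _ _ (by positivity) h.hB ?_
      intro y _
      rw [abs_mul, abs_of_nonneg (by positivity : (0 : ℚ) ≤ R ^ 5)]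
      gcongr
      exact spb y x
    push_cast at a2
    have e : (2 * (2 * R ^ 14 + R ^ 10) : ℚ) ≤ M := by
      have : 2 * (2 * R ^ 14 + R ^ 10) ≤ M := by
        refine le_trans ?_ hM1
        have := p2' 14 15 rfl; have := p2' 15 16 rfl; have := pp 10 14 (by norm_num); have := p2' 16 17 rfl
        omega
      exact_mod_cast this
    calc _ ≤ 2 * (R : ℚ) ^ 6 * (R ^ 4 * (R ^ 4 / c)) + (R : ℚ) * (R ^ 5 * (R ^ 4 / c)) :=
          add_le_add a2 a3
      _ = (2 * (2 * R ^ 14 + R ^ 10) / c) / 2 := by ring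
      _ ≤ m / 2 := by simp only [m]; gcongr
  have hm1 : 2 * m ≤ 1 := by
    simp only [m]
    rw [← mul_div_assoc, div_le_one hWp]
    have : 2 * M ≤ Fintype.card W := by
      have := p2' 18 19 rfl; have := pp 19 40 (by norm_num)
      omega
    rw [hc]
    exact_mod_cast this
  have hFT : ∀ x ∈ T, F x = 0 := by
    intro x hx
    simp only [F, A1, A2, A3, hx, if_true]
    simp [fun y => sp0 y x hx]
  have hFb : ∀ x, 0 ≤ F x ∧ F x ≤ 1 := by
    intro x
    by_cases hx : x ∈ T
    · rw [hFT x hx]; norm_num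
    · have h1 := abs_le.1 (hA1 x)
      have h2 := hA23 x
      have h3 := abs_le.1 (le_refl |A2 x|)
      have h4 := abs_le.1 (le_refl |A3 x|)
      simp only [F, hx, if_false]
      constructor <;> linarith
  have hFs : ∀ q : Ω × Ω, ∑ x, F x * ph x q = m * ∑ x : W, ph x q
      - ∑ i ∈ s, ∑ y ∈ N i, ph y q - R ^ 5 * ∑ b ∈ B, ph b q := by
    intro q
    have e0 : ∑ x, (if x ∈ T then 0 else m) * ph x q = m * ∑ x : W, ph x q - m * ∑ x ∈ T, ph x q := by
      rw [← Finset.sum_sdiff (Finset.subset_univ T) (f := fun x => ph x q), mul_add,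
        add_sub_cancel_right, Finset.mul_sum]
      rw [← Finset.sum_sdiff (Finset.subset_univ T)]
      rw [Finset.sum_eq_zero (s := T), add_zero]
      · refine Finset.sum_congr rfl fun x hx => ?_
        rw [if_neg (Finset.mem_sdiff.1 hx).2]
      · intro x hx; simp [hx]
    have e1 : ∑ x, A1 x * ph x q = m * ∑ x ∈ T, ph x q := by
      simp only [A1, Finset.sum_mul]
      rw [Finset.sum_comm, Finset.mul_sum]
      refine Finset.sum_congr rfl fun y _ => ?_
      rw [spe y q, Finset.mul_sum]
      exact Finset.sum_congr rfl fun x _ => by ring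
    have e2 : ∑ x, A2 x * ph x q = ∑ i ∈ s, ∑ y ∈ N i, ph y q := by
      simp only [A2, Finset.sum_mul]
      rw [Finset.sum_comm]
      refine Finset.sum_congr rfl fun i _ => ?_
      rw [Finset.sum_comm]
      refine Finset.sum_congr rfl fun y _ => ?_
      rw [spe y q]
    have e3 : ∑ x, A3 x * ph x q = R ^ 5 * ∑ b ∈ B, ph b q := by
      simp only [A3, Finset.sum_mul]
      rw [Finset.sum_comm, Finset.mul_sum]
      refine Finset.sum_congr rfl fun y _ => ?_
      rw [spe y q, Finset.mul_sum]
      exact Finset.sum_congr rfl fun x _ => by ring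
    simp only [F, sub_mul, add_mul, Finset.sum_sub_distrib, Finset.sum_add_distrib, e0, e1, e2, e3]
    ring
  obtain ⟨F', f0, f1, fz, fs, fc⟩ := rounding (Ω := Ω) F (fun x => (hFb x).1) (fun x => (hFb x).2)
  let Y1 : Finset W := Finset.univ.filter fun x => F' x = 1
  let S : Finset W := Finset.univ.filter fun x => 0 < F' x ∧ F' x < 1
  let f : W → ℚ := fun x => if x ∈ S then F' x else 0
  let e : Ω × Ω → ℚ := fun q => ∑ x, f x * ph x q
  have hsplit : ∀ q : Ω × Ω, ∑ x, F' x * ph x q = ∑ x ∈ Y1, ph x q + e q := by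
    intro q
    have : ∑ x ∈ Y1, ph x q = ∑ x, (if x ∈ Y1 then 1 else 0) * ph x q := by
      simp
    rw [this, ← Finset.sum_add_distrib]
    refine Finset.sum_congr rfl fun x _ => ?_
    rw [← add_mul]
    congr 1
    simp only [f, Y1, S, Finset.mem_filter, Finset.mem_univ, true_and]
    have := f0 x
    have := f1 x
    split_ifs with h1 h2 h3
    · linarith [h2.2]
    · linarith
    · ring
    · rcases lt_or_eq_of_le (f0 x) with h4 | h4
      · exact absurd ⟨h4, lt_of_le_of_ne (f1 x) h1⟩ h3
      · rw [← h4]; ring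
  have he : ∀ q, e q = m * ∑ x : W, ph x q
      - ∑ i ∈ s, ∑ y ∈ N i, ph y q - R ^ 5 * ∑ b ∈ B, ph b q - ∑ x ∈ Y1, ph x q := by
    intro q
    rw [← hFs, ← fs, hsplit]; ring
  have heL : e ∈ LL Ω B := by
    have hmean : (fun q : Ω × Ω => m * ∑ x : W, ph x q) ∈ LL Ω B := by
      refine ⟨fun b => R ^ 17 * ν b, fun q => ?_⟩
      have := h.hνs q q
      have sq : ∀ x : W, ph x q * ph x q = ph x q := fun x => by
        unfold ph; split_ifs <;> norm_num
      simp only [sq] at this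
      have e1 : ∑ b ∈ B, (ν b : ℚ) * ph b q = ∑ b, (ν b : ℚ) * ph b q :=
        Finset.sum_subset (Finset.subset_univ _) fun x _ hx => by simp [h.hνB x hx]
      push_cast
      simp_rw [mul_assoc, ← Finset.mul_sum]
      rw [e1, this]
      simp only [m, M]
      push_cast
      ring
    have : e = (fun q : Ω × Ω => m * ∑ x : W, ph x q)
      - ∑ i ∈ s, ∑ y ∈ N i, ph y - (R ^ 5) • ∑ b ∈ B, ph b - ∑ x ∈ Y1, ph x := by
      funext q
      rw [he]
      simp [Finset.sum_apply]
    rw [this]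
    refine sub_mem (sub_mem (sub_mem hmean ?_) ?_) ?_
    · exact sum_mem fun i _ => sum_mem fun y _ => h.hA y
    · exact nsmul_mem (sum_mem fun y _ => h.hA y) _
    · exact sum_mem fun y _ => h.hA y
  obtain ⟨z, hz, hze⟩ := intcomb h f
    (fun x => by simp only [f]; split_ifs; exacts [f0 x, le_rfl])
    (fun x => by simp only [f]; split_ifs; exacts [f1 x, zero_le_one])
    S (fc.trans h.hN) (fun x hx => if_neg hx) e (fun q => rfl) heL
  let X : W × ℕ → Finset W := fun i => if (i.2 : ℤ) < z i.1 + R ^ 5 then P i else N i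
  have hXs : ∀ i, X i ⊆ P i ∪ N i := by
    intro i
    simp only [X]
    split_ifs
    exacts [Finset.subset_union_left, Finset.subset_union_right]
  have hXdis : (s : Set (W × ℕ)).PairwiseDisjoint X := by
    intro i hi j hj hij
    exact Finset.disjoint_of_subset_left (hXs i) (Finset.disjoint_of_subset_right (hXs j)
      (hdis i hi j hj hij))
  have hY1 : Disjoint Y1 (s.biUnion X) := by
    rw [Finset.disjoint_left]
    intro x hx hx2
    have : x ∈ T := by
      obtain ⟨i, hi, hxi⟩ := Finset.mem_biUnion.1 hx2
      exact Finset.mem_biUnion.2 ⟨i, hi, hXs i hxi⟩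
    have h2 := fz x (hFT x this)
    have h3 := (Finset.mem_filter.1 hx).2
    rw [h2] at h3
    norm_num at h3
  refine ⟨Y1 ∪ s.biUnion X, M, hM0, hM2, fun q => ?_⟩
  rw [Finset.sum_union hY1, Finset.sum_biUnion hXdis]
  have hXi : ∀ i ∈ s, ∑ x ∈ X i, ph x q = ∑ x ∈ N i, ph x q +
      (if (i.2 : ℤ) < z i.1 + R ^ 5 then ph i.1 q else 0) := by
    intro i hi
    simp only [X]
    split_ifs
    · rw [(hPN i hi).eq]; ring
    · ring
  rw [Finset.sum_congr rfl hXi, Finset.sum_add_distrib]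
  have hlast : ∑ i ∈ s, (if (i.2 : ℤ) < z i.1 + R ^ 5 then ph i.1 q else 0) =
      ∑ b ∈ B, ((z b : ℚ) + R ^ 5) * ph b q := by
    simp only [s]
    rw [Finset.sum_product]
    refine Finset.sum_congr rfl fun b _ => ?_
    have hzb := abs_le.1 (hz b)
    rw [← Finset.sum_filter]
    dsimp only
    rw [Finset.sum_const, nsmul_eq_mul]
    congr 1
    have : (Finset.range (2 * R ^ 5)).filter (fun j : ℕ => (j : ℤ) < z b + R ^ 5) =
        Finset.range (z b + R ^ 5).toNat := by
      ext j
      simp only [Finset.mem_filter, Finset.mem_range, Int.lt_toNat]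
      constructor
      · exact fun h => h.2
      · intro h
        refine ⟨?_, h⟩
        have : (j : ℤ) < ((2 * R ^ 5 : ℕ) : ℤ) := by push_cast; linarith
        exact_mod_cast this
    rw [this, Finset.card_range]
    have h2 : (((z b + R ^ 5).toNat : ℤ) : ℚ) = ((z b + R ^ 5 : ℤ) : ℚ) := by
      rw [Int.toNat_of_nonneg (by linarith)]
    push_cast at h2
    exact h2
  rw [hlast]
  have h5 := he q
  rw [hze q] at h5
  simp_rw [add_mul, Finset.sum_add_distrib, ← Finset.mul_sum]
  linarith

end Main
end SD

namespace SD
section Concrete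

/-- points -/
@[ext] structure Pt (G : Type*) (n : ℕ) where
  /-- label -/
  fst : G
  /-- position -/
  snd : Fin n

/-- equivalence with pairs -/
def ptEquiv (G : Type*) (n : ℕ) : G × Fin n ≃ Pt G n where
  toFun p := ⟨p.1, p.2⟩
  invFun p := (p.1, p.2)
  left_inv _ := rfl
  right_inv _ := rfl

instance (G : Type*) [Fintype G] (n : ℕ) : Fintype (Pt G n) := Fintype.ofEquiv _ (ptEquiv G n)

variable {G : Type*} [CommGroup G] {n : ℕ}

instance instActPt : MulAction (Wr G n) (Pt G n) where
  smul w p := ptEquiv G n (wAct w (p.1, p.2))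
  one_smul p := by
    change ptEquiv G n (wAct 1 (p.1, p.2)) = p
    simp [wAct, ptEquiv]
  mul_smul w v p := by
    change ptEquiv G n (wAct (w * v) (p.1, p.2)) = ptEquiv G n (wAct w (wAct v (p.1, p.2)))
    simp only [wAct, SemidirectProduct.mul_left, SemidirectProduct.mul_right, Pi.mul_apply,
      Equiv.Perm.mul_apply]
    have : (permMulAut G n w.right) v.left (w.right (v.right p.2)) = v.left (v.right p.2) := by
      simp [permMulAut, MulEquiv.arrowCongr]
    rw [this, mul_comm (w.left _), mul_assoc]

lemma smul_pt (w : Wr G n) (c : G) (x : Fin n) :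
    w • (⟨c, x⟩ : Pt G n) = ⟨c * w.left (w.right x), w.right x⟩ := rfl

/-- `w` fixes the fibre over `x` -/
def Fx (w : Wr G n) (x : Fin n) : Prop := w.right x = x ∧ w.left x = 1

lemma Fx.smul {w : Wr G n} {p : Pt G n} (h : Fx w p.2) : w • p = p := by
  obtain ⟨c, x⟩ := p
  rw [smul_pt]
  simp only [Fx] at h
  rw [h.1, h.2, mul_one]

lemma Fx.sm {w : Wr G n} {x : Fin n} (h : Fx w x) (c : G) :
    w • (⟨c, x⟩ : Pt G n) = ⟨c, x⟩ := Fx.smul h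

lemma Fx_iff {w : Wr G n} {x : Fin n} : Fx w x ↔ w • (⟨1, x⟩ : Pt G n) = ⟨1, x⟩ := by
  refine ⟨fun h => Fx.smul h, fun h => ?_⟩
  rw [smul_pt] at h
  have h1 : w.right x = x := congrArg Pt.snd h
  have h2 : 1 * w.left (w.right x) = 1 := congrArg Pt.fst h
  rw [h1, one_mul] at h2
  exact ⟨h1, h2⟩

open Classical in
/-- support -/
noncomputable def sup (w : Wr G n) : Finset (Fin n) := Finset.univ.filter fun x => ¬ Fx w x

lemma notMem_sup {w : Wr G n} {x : Fin n} : x ∉ sup w ↔ Fx w x := by simp [sup]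
lemma mem_sup {w : Wr G n} {x : Fin n} : x ∈ sup w ↔ ¬ Fx w x := by simp [sup]

/-- the elements fixing all fibres over `A` -/
def fixS (A : Set (Fin n)) : Subgroup (Wr G n) :=
  fixingSubgroup (Wr G n) {p : Pt G n | p.2 ∈ A}

lemma mem_fixS {A : Set (Fin n)} {w : Wr G n} : w ∈ fixS A ↔ ∀ x ∈ A, Fx w x := by
  rw [fixS, mem_fixingSubgroup_iff]
  constructor
  · intro h x hx
    exact Fx_iff.2 (h ⟨1, x⟩ hx)
  · intro h p hp
    exact (h _ hp).smul

noncomputable instance [Fintype G] : Fintype (Wr G n) :=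
  Fintype.ofEquiv _ (SemidirectProduct.equivProd (φ := permMulAut G n)).symm

/-- elementary reduction element -/
def tau (h : Wr G n) (x : Fin n) : Wr G n :=
  ⟨Pi.mulSingle (h.right⁻¹ x) (h.left x)⁻¹, Equiv.swap x (h.right⁻¹ x)⟩

lemma tau_fx (h : Wr G n) (x z : Fin n) (h1 : z ≠ x) (h2 : z ≠ h.right⁻¹ x) : Fx (tau h x) z := by
  refine ⟨Equiv.swap_apply_of_ne_of_ne h1 h2, ?_⟩
  simp only [tau]
  exact Pi.mulSingle_eq_of_ne h2 _

lemma tau_pt (h : Wr G n) (x : Fin n) (c : G) :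
    tau h x • (⟨c, x⟩ : Pt G n) = ⟨c * (h.left x)⁻¹, h.right⁻¹ x⟩ := by
  rw [smul_pt]
  simp [tau]

lemma tau_snd (h : Wr G n) (x : Fin n) (p : Pt G n) :
    (tau h x • p).2 = p.2 ∨ (tau h x • p).2 = x ∨ (tau h x • p).2 = h.right⁻¹ x := by
  obtain ⟨c, z⟩ := p
  rw [smul_pt]
  simp only [tau]
  rcases eq_or_ne z x with rfl | h1
  · right; right; simp
  · rcases eq_or_ne z (h.right⁻¹ x) with rfl | h2
    · right; left; simp
    · left; exact Equiv.swap_apply_of_ne_of_ne h1 h2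

lemma mem_sup_inv {h : Wr G n} {x : Fin n} (hx : x ∈ sup h) : h.right⁻¹ x ∈ sup h := by
  rw [mem_sup] at hx ⊢
  intro hf
  have h1 : x = h.right⁻¹ x := by simpa using hf.1
  rw [← h1] at hf
  exact hx hf

/-- iterated differences -/
noncomputable def EE {W Ω : Type*} [Group W] [MulAction W Ω] (h : W) : List W → Ω × Ω → ℚ
  | [], q => ph h q
  | τ :: l, q => EE h l q - EE h l (τ • q.1, q.2)

lemma EE_mem {W Ω : Type*} [Group W] [MulAction W Ω] (h : W) (L : AddSubgroup (Ω × Ω → ℚ))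
    (C : Subgroup W) (l : List W) (hl : ∀ τ ∈ l, τ ∈ C) (m : W)
    (hm : ∀ p ∈ C, (ph (h * p * m) : Ω × Ω → ℚ) ∈ L) :
    (fun q : Ω × Ω => EE h l (m • q.1, q.2)) ∈ L := by
  induction l generalizing m with
  | nil =>
    have := hm 1 C.one_mem
    convert this using 1
    funext q
    simp only [EE, mul_one]
    rw [ph_right]
  | cons τ l ih =>
    have hl' : ∀ σ ∈ l, σ ∈ C := fun σ hσ => hl σ (List.mem_cons_of_mem _ hσ)
    have h1 := ih hl' m hm
    have h2 := ih hl' (τ * m) (fun p hp => by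
      have := hm (p * τ) (C.mul_mem hp (hl τ List.mem_cons_self))
      rwa [show h * p * (τ * m) = h * (p * τ) * m by group])
    have := L.sub_mem h1 h2
    convert this using 1
    funext q
    simp [EE, mul_smul]

/-- disjointness of pairs -/
def Dj (π : Equiv.Perm (Fin n)) (x x' : Fin n) : Prop :=
  x ≠ x' ∧ x ≠ π⁻¹ x' ∧ π⁻¹ x ≠ x' ∧ π⁻¹ x ≠ π⁻¹ x'

lemma exists_points (h : Wr G n) (m : ℕ) (hm : 3 * m ≤ (sup h).card) :
    ∃ xs : List (Fin n), xs.length = m ∧ (∀ x ∈ xs, x ∈ sup h) ∧ xs.Pairwise (Dj h.right) := by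
  classical
  induction m with
  | zero => exact ⟨[], by simp⟩
  | succ m ih =>
    obtain ⟨xs, h1, h2, h3⟩ := ih (by omega)
    let bad : Finset (Fin n) := xs.toFinset.biUnion fun x => {x, h.right⁻¹ x, h.right x}
    have hbad : bad.card < (sup h).card := by
      refine lt_of_le_of_lt (Finset.card_biUnion_le_card_mul _ _ 3 fun x _ => ?_) ?_
      · exact Finset.card_le_three
      · have := List.toFinset_card_le xs
        omega
    obtain ⟨x, hx, hxb⟩ := Finset.exists_mem_notMem_of_card_lt_card hbad
    refine ⟨x :: xs, by simp [h1], ?_, ?_⟩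
    · intro y hy
      rcases List.mem_cons.1 hy with rfl | hy
      · exact hx
      · exact h2 y hy
    · refine List.pairwise_cons.2 ⟨fun y hy => ?_, h3⟩
      have hn : x ∉ ({y, h.right⁻¹ y, h.right y} : Finset (Fin n)) := fun hc =>
        hxb (Finset.mem_biUnion.2 ⟨y, List.mem_toFinset.2 hy, hc⟩)
      simp only [Finset.mem_insert, Finset.mem_singleton, not_or] at hn
      refine ⟨hn.1, hn.2.1, ?_, ?_⟩
      · intro hh
        exact hn.2.2 (by rw [← hh]; simp)
      · intro hh
        exact hn.1 (h.right⁻¹.injective hh)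

lemma EE_zero {t : ℕ} (h g : Wr G n) (xs : List (Fin n)) (hxs : xs.Pairwise (Dj h.right))
    (a b : Fin t → Pt G n)
    (hex : ∃ x ∈ xs, ∀ s, (a s).2 ≠ x ∧ (a s).2 ≠ h.right⁻¹ x) :
    EE g (xs.map (tau h)) (a, b) = 0 := by
  induction xs generalizing a with
  | nil => simp at hex
  | cons x0 xs ih =>
    rw [List.pairwise_cons] at hxs
    simp only [List.map_cons, EE]
    by_cases h0 : ∀ s, (a s).2 ≠ x0 ∧ (a s).2 ≠ h.right⁻¹ x0
    · have : tau h x0 • a = a := by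
        funext s
        exact (tau_fx h x0 _ (h0 s).1 (h0 s).2).smul
      rw [this, sub_self]
    · obtain ⟨x, hx, hxa⟩ := hex
      have hx' : x ∈ xs := by
        rcases List.mem_cons.1 hx with rfl | hx
        · exact absurd hxa h0
        · exact hx
      rw [ih hxs.2 a ⟨x, hx', hxa⟩, ih hxs.2 (tau h x0 • a) ⟨x, hx', ?_⟩, sub_self]
      intro s
      have hd := hxs.1 x hx'
      rcases tau_snd h x0 (a s) with h1 | h1 | h1
      · change (tau h x0 • a s).2 ≠ x ∧ (tau h x0 • a s).2 ≠ _
        rw [h1]; exact hxa s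
      · change (tau h x0 • a s).2 ≠ x ∧ (tau h x0 • a s).2 ≠ _
        rw [h1]; exact ⟨hd.1, hd.2.1⟩
      · change (tau h x0 • a s).2 ≠ x ∧ (tau h x0 • a s).2 ≠ _
        rw [h1]; exact ⟨hd.2.2.1, hd.2.2.2⟩

lemma EE_sub {t : ℕ} (h : Wr G n) (xs : List (Fin n)) (hxs : xs.Pairwise (Dj h.right))
    (hsup : ∀ x ∈ xs, x ∈ sup h)
    (L : AddSubgroup ((Fin t → Pt G n) × (Fin t → Pt G n) → ℚ))
    (hL : ∀ w : Wr G n, (sup w).card < (sup h).card → ph w ∈ L) :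
    EE h (xs.map (tau h)) - ph h ∈ L := by
  induction xs with
  | nil =>
    have : EE h (List.map (tau h) []) - ph h = (0 : (Fin t → Pt G n) × (Fin t → Pt G n) → ℚ) := by
      funext q; simp [EE]
    rw [this]; exact L.zero_mem
  | cons x xs ih =>
    rw [List.pairwise_cons] at hxs
    have h1 := ih hxs.2 (fun y hy => hsup y (List.mem_cons_of_mem _ hy))
    have hx := hsup x List.mem_cons_self
    let A : Set (Fin n) := {z | z = x ∨ z = h.right⁻¹ x ∨ z ∉ sup h}
    have h2 := EE_mem (Ω := Fin t → Pt G n) h L (fixS A) (xs.map (tau h)) (by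
      intro τ hτ
      obtain ⟨y, hy, rfl⟩ := List.mem_map.1 hτ
      rw [mem_fixS]
      have hd := hxs.1 y hy
      have hys := hsup y (List.mem_cons_of_mem _ hy)
      rintro z (rfl | rfl | hz)
      · exact tau_fx _ _ _ hd.1 hd.2.1
      · exact tau_fx _ _ _ hd.2.2.1 hd.2.2.2
      · refine tau_fx _ _ _ (fun hh => hz (hh ▸ hys)) (fun hh => hz (hh ▸ mem_sup_inv hys)))
      (tau h x) (by
      intro p hp
      rw [mem_fixS] at hp
      apply hL
      apply Finset.card_lt_card
      rw [Finset.ssubset_iff_of_subset]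
      · refine ⟨x, hx, ?_⟩
        rw [notMem_sup, Fx_iff, mul_smul, mul_smul, tau_pt, (hp _ (Or.inr (Or.inl rfl))).sm, smul_pt]
        simp
      · intro z hz
        by_contra hzs
        rw [mem_sup] at hz
        apply hz
        have hzx : z ≠ x := fun hh => hzs (hh ▸ hx)
        have hzy : z ≠ h.right⁻¹ x := fun hh => hzs (hh ▸ mem_sup_inv hx)
        rw [Fx_iff, mul_smul, mul_smul, (tau_fx h x z hzx hzy).sm,
          (hp z (Or.inr (Or.inr hzs))).sm, (notMem_sup.1 hzs).sm])
    have h3 := L.sub_mem h1 h2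
    convert h3 using 1
    funext q
    simp [EE]
    ring

theorem A0 [Fintype G] {t : ℕ} (ht : 1 ≤ t) (B : Finset (Wr G n))
    (hB : ∀ w : Wr G n, (sup w).card ≤ 5 * t → w ∈ B) (g : Wr G n) :
    ph g ∈ LL (Fin t → Pt G n) B := by
  classical
  induction hm : (sup g).card using Nat.strong_induction_on generalizing g with
  | _ m ih =>
  by_cases hle : (sup g).card ≤ 5 * t
  · refine ⟨fun b => if b = g then 1 else 0, fun q => ?_⟩
    simp [hB g hle]
  · obtain ⟨xs, h1, h2, h3⟩ := exists_points g (t + 1) (by omega)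
    have h4 := EE_sub (t := t) g xs h3 h2 (LL (Fin t → Pt G n) B)
      (fun w hw => ih _ (hm ▸ hw) w rfl)
    have h5 : EE g (xs.map (tau g)) = (0 : (Fin t → Pt G n) × (Fin t → Pt G n) → ℚ) := by
      funext ⟨a, b⟩
      refine EE_zero g g xs h3 a b ?_
      by_contra hcon
      push Not at hcon
      have hc : ∀ i : Fin xs.length, ∃ s, (a s).2 = xs.get i ∨ (a s).2 = g.right⁻¹ (xs.get i) := by
        intro i
        obtain ⟨s, hs⟩ := hcon (xs.get i) (List.get_mem _ _)
        exact ⟨s, or_iff_not_imp_left.2 hs⟩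
      choose f hf using hc
      have hinj : Function.Injective f := by
        have key : ∀ i j : Fin xs.length, i < j → f i ≠ f j := by
          intro i j hij hfe
          have hd := List.pairwise_iff_get.1 h3 i j hij
          have a1 := hf i
          have a2 := hf j
          rw [← hfe] at a2
          rcases a1 with a1 | a1 <;> rcases a2 with a2 | a2 <;> rw [a1] at a2
          · exact hd.1 a2
          · exact hd.2.1 a2
          · exact hd.2.2.1 a2
          · exact hd.2.2.2 a2
        intro i j hij
        rcases lt_trichotomy i j with hl | hl | hl
        · exact absurd hij (key i j hl)
        · exact hl
        · exact absurd hij.symm (key j i hl)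
      have := Fintype.card_le_of_injective f hinj
      simp [h1] at this
    rw [h5, zero_sub] at h4
    exact neg_mem_iff.1 h4

end Concrete
end SD

namespace SD
section Nu

lemma extrap (T N N' : ℕ) (hN : N ≤ N') (h1 : 1 ≤ N') : ∃ c : ℕ → ℤ,
    (∀ j, |c j| ≤ (T + 1) * (2 * N') ^ T) ∧
    ∀ s d : ℕ, d ≤ T →
      ((s + N).choose d : ℤ) = ∑ j ∈ Finset.range (T + 1), c j * ((s + j).choose d : ℤ) := by
  refine ⟨fun j => ∑ k ∈ Finset.range (T + 1),
    (N.choose k : ℤ) * ((-1) ^ (k - j) * (k.choose j : ℤ)), ?_, ?_⟩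
  · intro j
    refine (Finset.abs_sum_le_sum_abs _ _).trans ?_
    have : ∀ k ∈ Finset.range (T + 1),
        |(N.choose k : ℤ) * ((-1) ^ (k - j) * (k.choose j : ℤ))| ≤ (2 * N') ^ T := by
      intro k hk
      rw [abs_mul, abs_mul, abs_pow, abs_neg, abs_one, one_pow, one_mul, Nat.abs_cast,
        Nat.abs_cast]
      have hk' : k ≤ T := by simpa [Nat.lt_succ_iff] using hk
      have e1 : N.choose k ≤ N' ^ T :=
        (Nat.choose_le_pow N k).trans ((Nat.pow_le_pow_left hN k).trans
          (Nat.pow_le_pow_right h1 hk'))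
      have e2 : k.choose j ≤ 2 ^ T :=
        (Nat.choose_le_two_pow k j).trans (Nat.pow_le_pow_right (by norm_num) hk')
      have := Nat.mul_le_mul e1 e2
      rw [← mul_pow, mul_comm N'] at this
      exact_mod_cast this
    refine (Finset.sum_le_sum this).trans ?_
    simp
  · intro s d hd
    have hz : ∀ k, T < k → (fwdDiff (1 : ℕ))^[k] (fun x => (x.choose d : ℤ)) = fun _ => 0 := by
      intro k hk
      obtain ⟨e, rfl⟩ : ∃ e, k = e + 1 + d := ⟨k - 1 - d, by omega⟩
      rw [Function.iterate_add_apply]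
      have := fwdDiff_iter_choose 0 d
      simp only [add_zero, Nat.choose_zero_right, Nat.cast_one] at this
      rw [this, Function.iterate_add_apply]
      simp only [Function.iterate_one, fwdDiff_const]
      clear hk this
      induction e with
      | zero => rfl
      | succ e ih => rw [Function.iterate_succ_apply, fwdDiff_const, ih]
    have h := shift_eq_sum_fwdDiff_iter (1 : ℕ) (fun x : ℕ => (x.choose d : ℤ)) N s
    simp only [smul_eq_mul, mul_one, nsmul_eq_mul] at h
    rw [h]
    have ext : ∑ k ∈ Finset.range (N + 1), (N.choose k : ℤ) *
          (fwdDiff (1 : ℕ))^[k] (fun x => (x.choose d : ℤ)) s =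
        ∑ k ∈ Finset.range (T + 1), (N.choose k : ℤ) *
          (fwdDiff (1 : ℕ))^[k] (fun x => (x.choose d : ℤ)) s := by
      rcases le_total N T with hNT | hNT
      · refine Finset.sum_subset (Finset.range_mono (by omega)) ?_
        intro k _ hk
        rw [Nat.choose_eq_zero_of_lt (by simpa using hk)]; simp
      · symm
        refine Finset.sum_subset (Finset.range_mono (by omega)) ?_
        intro k _ hk
        rw [hz k (by simpa [Nat.lt_succ_iff] using hk)]; simp
    rw [ext]
    simp_rw [Finset.sum_mul]
    rw [Finset.sum_comm]
    refine Finset.sum_congr rfl fun k hk => ?_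
    have hk' : k ≤ T := by simpa [Nat.lt_succ_iff] using hk
    rw [fwdDiff_iter_eq_sum_shift]
    simp only [smul_eq_mul, mul_one]
    rw [Finset.mul_sum]
    refine Finset.sum_subset_zero_on_sdiff (Finset.range_mono (by omega)) ?_ ?_
    · intro j hj
      rw [Finset.mem_sdiff] at hj
      rw [Nat.choose_eq_zero_of_lt (n := k) (k := j) (by simpa using hj.2)]; simp
    · intro j _
      ring

variable {G : Type*} [CommGroup G] {n : ℕ} [Fintype G]

open Classical in
/-- the event of agreeing with `w0` on `A` -/
noncomputable def ev (A : Finset (Fin n)) (w0 : Wr G n) : Finset (Wr G n) :=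
  Finset.univ.filter fun w => ∀ x ∈ A, w • (⟨1, x⟩ : Pt G n) = w0 • (⟨1, x⟩ : Pt G n)

lemma mem_ev {A : Finset (Fin n)} {w0 w : Wr G n} : w ∈ ev A w0 ↔
    ∀ x ∈ A, w • (⟨1, x⟩ : Pt G n) = w0 • (⟨1, x⟩ : Pt G n) := by simp [ev]

lemma mem_ev' {A : Finset (Fin n)} {w0 w : Wr G n} : w ∈ ev A w0 ↔
    ∀ x ∈ A, w.right x = w0.right x ∧ w.left (w0.right x) = w0.left (w0.right x) := by
  rw [mem_ev]
  refine forall₂_congr fun x _ => ?_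
  rw [smul_pt, smul_pt, Pt.mk.injEq, one_mul, one_mul]
  constructor
  · rintro ⟨h1, h2⟩
    rw [h2] at h1
    exact ⟨h2, h1⟩
  · rintro ⟨h1, h2⟩
    rw [h1]
    exact ⟨h2, rfl⟩

lemma card_fixp (S : Finset (Fin n)) :
    Fintype.card {π : Equiv.Perm (Fin n) // ∀ x, ¬ x ∉ S → π x = x} = (n - S.card).factorial := by
  rw [← Fintype.card_congr (Equiv.Perm.subtypeEquivSubtypePerm fun x => x ∉ S),
    Fintype.card_perm, Fintype.card_subtype_compl]
  simp

lemma card_ev_one (S : Finset (Fin n)) : (ev S (1 : Wr G n)).card =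
    Fintype.card G ^ (n - S.card) * (n - S.card).factorial := by
  classical
  have : (ev S (1 : Wr G n)).card =
      ((Fintype.piFinset fun x : Fin n => if x ∈ S then ({1} : Finset G) else Finset.univ) ×ˢ
      (Finset.univ.filter fun π : Equiv.Perm (Fin n) => ∀ x, ¬ x ∉ S → π x = x)).card := by
    refine Finset.card_equiv SemidirectProduct.equivProd ?_
    intro w
    rw [mem_ev', Finset.mem_product, Fintype.mem_piFinset]
    simp only [SemidirectProduct.equivProd, Equiv.coe_fn_mk, SemidirectProduct.one_right,
      SemidirectProduct.one_left, Equiv.Perm.coe_one, id_eq, Pi.one_apply, Finset.mem_filter,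
      Finset.mem_univ, true_and, not_not]
    constructor
    · intro h
      refine ⟨fun x => ?_, fun x hx => (h x hx).1⟩
      split_ifs with hx
      · simpa using (h x hx).2
      · simp
    · rintro ⟨h1, h2⟩ x hx
      refine ⟨h2 x hx, ?_⟩
      have := h1 x
      rw [if_pos hx] at this
      simpa using this
  rw [this, Finset.card_product, Fintype.card_piFinset, ← card_fixp S, Fintype.card_subtype]
  congr 1
  have : ∀ x, (if x ∈ S then ({1} : Finset G) else Finset.univ).card =
      if x ∈ S then 1 else Fintype.card G := by
    intro x; split_ifs <;> simp
  simp_rw [this]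
  rw [Finset.prod_ite]
  simp only [Finset.prod_const, one_pow, one_mul]
  congr 1
  have : (Finset.univ.filter fun x => x ∉ S) = Sᶜ := by ext; simp
  rw [this, Finset.card_compl]; simp

lemma card_ev (S : Finset (Fin n)) (w1 : Wr G n) : (ev S w1).card =
    Fintype.card G ^ (n - S.card) * (n - S.card).factorial := by
  rw [← card_ev_one (G := G) S]
  refine Finset.card_equiv (Equiv.mulLeft w1⁻¹) ?_
  intro w
  rw [mem_ev, mem_ev]
  refine forall₂_congr fun x _ => ?_
  rw [Equiv.coe_mulLeft, mul_smul, one_smul, inv_smul_eq_iff]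

lemma card_Wr : Fintype.card (Wr G n) = Fintype.card G ^ n * n.factorial := by
  have := card_ev_one (G := G) (n := n) ∅
  simp only [Finset.card_empty, Nat.sub_zero] at this
  rw [← this, ← Finset.card_univ]
  congr 1
  ext w; simp [mem_ev]

open Classical in
lemma card_evX (A X : Finset (Fin n)) (w0 : Wr G n) (hA : ∀ x ∈ A, ¬ Fx w0 x) :
    ((ev A w0).filter fun w => sup w ⊆ X).card =
      if A ∪ A.image w0.right ⊆ X then
        Fintype.card G ^ (X.card - A.card) * (X.card - A.card).factorial else 0 := by
  split_ifs with hU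
  · have hAX : A ⊆ X := Finset.union_subset_left hU
    have hBX : ∀ x ∈ A, w0.right x ∈ X := fun x hx =>
      hU (Finset.mem_union_right _ (Finset.mem_image_of_mem _ hx))
    obtain ⟨σ, hσ⟩ : ∃ σ : Fin n ≃ (Finset.univ : Finset (Fin n)), ∀ x ∈ (A ∪ Xᶜ : Finset (Fin n)),
        (σ x : Fin n) = if x ∈ A then w0.right x else x := by
      refine Finset.exists_equiv_extend_of_card_eq (by simp) (by simp) ?_
      intro x hx y hy hxy
      simp only [Finset.coe_union, Set.mem_union, Finset.mem_coe, Finset.mem_compl] at hx hy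
      simp only at hxy
      split_ifs at hxy with h1 h2 h2
      · exact w0.right.injective hxy
      · have := hBX x h1
        rw [hxy] at this
        tauto
      · have := hBX y h2
        rw [← hxy] at this
        tauto
      · exact hxy
    let π : Equiv.Perm (Fin n) := σ.trans ((Equiv.subtypeUnivEquiv (by simp)))
    have hπ : ∀ x ∈ (A ∪ Xᶜ : Finset (Fin n)), π x = if x ∈ A then w0.right x else x := hσ
    let w1 : Wr G n := ⟨fun y => if y ∈ A.image w0.right then w0.left y else 1, π⟩
    have hset : ((ev A w0).filter fun w => sup w ⊆ X) = ev (A ∪ Xᶜ) w1 := by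
      ext w
      rw [Finset.mem_filter, mem_ev', mem_ev']
      have key : sup w ⊆ X ↔ ∀ x, x ∉ X → Fx w x := by
        constructor
        · intro h x hx
          exact notMem_sup.1 fun h' => hx (h h')
        · intro h x hx
          by_contra h'
          exact (mem_sup.1 hx) (h x h')
      rw [key]
      have hx1 : ∀ x ∈ A, w1.right x = w0.right x ∧ w1.left (w0.right x) = w0.left (w0.right x) := by
        intro x hx
        refine ⟨?_, ?_⟩
        · exact (hπ x (Finset.mem_union_left _ hx)).trans (if_pos hx)
        · exact if_pos (Finset.mem_image_of_mem _ hx)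
      have hx2 : ∀ x, x ∉ X → w1.right x = x ∧ w1.left x = 1 := by
        intro x hx
        refine ⟨?_, ?_⟩
        · exact (hπ x (Finset.mem_union_right _ (by simpa using hx))).trans
            (if_neg fun h => hx (hAX h))
        · refine if_neg fun h => ?_
          obtain ⟨y, hy, rfl⟩ := Finset.mem_image.1 h
          exact hx (hBX y hy)
      constructor
      · rintro ⟨h1, h2⟩ x hx
        rcases Finset.mem_union.1 hx with hx | hx
        · rw [(hx1 x hx).1, (hx1 x hx).2]; exact h1 x hx
        · have hx : x ∉ X := by simpa using hx
          rw [(hx2 x hx).1, (hx2 x hx).2]; exact h2 x hx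
      · intro h
        refine ⟨fun x hx => ?_, fun x hx => ?_⟩
        · have := h x (Finset.mem_union_left _ hx)
          rwa [(hx1 x hx).1, (hx1 x hx).2] at this
        · have := h x (Finset.mem_union_right _ (by simpa using hx))
          rwa [(hx2 x hx).1, (hx2 x hx).2] at this
    rw [hset, card_ev]
    have hc : n - (A ∪ Xᶜ).card = X.card - A.card := by
      rw [Finset.card_union_of_disjoint, Finset.card_compl, Fintype.card_fin]
      · have := Finset.card_le_univ X
        rw [Fintype.card_fin] at this
        omega
      · rw [Finset.disjoint_right]
        intro x hx hx'
        exact (Finset.mem_compl.1 hx) (hAX hx')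
    rw [hc]
  · rw [Finset.card_eq_zero, Finset.filter_eq_empty_iff]
    intro w hw hs
    apply hU
    rw [mem_ev'] at hw
    have h0 : ∀ x ∈ A, x ∈ sup w := by
      intro x hx
      rw [mem_sup]
      rintro ⟨h1, h2⟩
      obtain ⟨h3, h4⟩ := hw x hx
      apply hA x hx
      rw [h1] at h3
      rw [← h3] at h4
      exact ⟨h3.symm, by rw [← h4]; exact h2⟩
    refine Finset.union_subset (fun x hx => hs (h0 x hx)) ?_
    intro y hy
    obtain ⟨x, hx, rfl⟩ := Finset.mem_image.1 hy
    apply hs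
    rw [mem_sup]
    rintro ⟨h1, h2⟩
    obtain ⟨h3, h4⟩ := hw x hx
    have : w0.right x = x := w.right.injective (by rw [h1, h3])
    apply mem_sup.1 (h0 x hx)
    rw [this] at h3 h2
    exact ⟨h3, h2⟩

end Nu
end SD

namespace SD
section Nu2

open Classical in
lemma card_super {n : ℕ} (U : Finset (Fin n)) (m : ℕ) (h : U.card ≤ m) :
    ((Finset.powersetCard m (Finset.univ : Finset (Fin n))).filter fun X => U ⊆ X).card =
      (n - U.card).choose (m - U.card) := by
  have : (n - U.card) = (Uᶜ).card := by rw [Finset.card_compl, Fintype.card_fin]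
  rw [this, ← Finset.card_powersetCard]
  refine Finset.card_bij' (fun X _ => X \ U) (fun Z _ => Z ∪ U) ?_ ?_ ?_ ?_
  · intro X hX
    simp only [Finset.mem_filter, Finset.mem_powersetCard, Finset.subset_univ, true_and] at hX ⊢
    refine ⟨fun x hx => ?_, ?_⟩
    · simp at hx ⊢; exact hx.2
    · rw [Finset.card_sdiff_of_subset hX.2, hX.1]
  · intro Z hZ
    simp only [Finset.mem_filter, Finset.mem_powersetCard, Finset.subset_univ, true_and] at hZ ⊢
    refine ⟨?_, Finset.subset_union_right⟩
    rw [Finset.card_union_of_disjoint, hZ.2]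
    · omega
    · rw [Finset.disjoint_left]
      intro x hx
      simpa using hZ.1 hx
  · intro X hX
    simp only [Finset.mem_filter] at hX
    exact Finset.sdiff_union_of_subset hX.2
  · intro Z hZ
    simp only [Finset.mem_powersetCard] at hZ
    rw [Finset.union_sdiff_right]
    refine Finset.sdiff_eq_self_of_disjoint ?_
    rw [Finset.disjoint_left]
    intro x hx
    simpa using hZ.1 hx

open Classical in
lemma card_super_zero {n : ℕ} (U : Finset (Fin n)) (m : ℕ) (h : m < U.card) :
    ((Finset.powersetCard m (Finset.univ : Finset (Fin n))).filter fun X => U ⊆ X).card = 0 := by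
  rw [Finset.card_eq_zero, Finset.filter_eq_empty_iff]
  intro X hX hU
  rw [Finset.mem_powersetCard] at hX
  have := Finset.card_le_card hU
  omega

lemma arith1 (n T m u α r : ℕ) (hT : 2 * T ≤ n) (hm : T ≤ m) (hm2 : m ≤ 2 * T) (hα : α ≤ T)
    (hαu : α ≤ u) (hu : u ≤ m) :
    ((n - m).descFactorial (2 * T - m) * r ^ (2 * T - m)) * ((n - u).choose (m - u) *
      (r ^ (m - α) * (m - α).factorial)) =
    (r ^ (2 * T - α) * (n - u).descFactorial (2 * T - u) * (u - α).factorial) *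
      (m - α).choose (u - α) := by
  have hr : r ^ (2 * T - α) = r ^ (2 * T - m) * r ^ (m - α) := by
    rw [← pow_add]; congr 1; omega
  have h1 : (n - 2 * T).factorial * (n - m).descFactorial (2 * T - m) = (n - m).factorial := by
    have := Nat.factorial_mul_descFactorial (n := n - m) (k := 2 * T - m) (by omega)
    rwa [show n - m - (2 * T - m) = n - 2 * T by omega] at this
  have h2 : (n - 2 * T).factorial * (n - u).descFactorial (2 * T - u) = (n - u).factorial := by
    have := Nat.factorial_mul_descFactorial (n := n - u) (k := 2 * T - u) (by omega)
    rwa [show n - u - (2 * T - u) = n - 2 * T by omega] at this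
  have h3 : (n - u).choose (m - u) * (m - u).factorial * (n - m).factorial = (n - u).factorial := by
    have := Nat.choose_mul_factorial_mul_factorial (n := n - u) (k := m - u) (by omega)
    rwa [show n - u - (m - u) = n - m by omega] at this
  have h4 : (m - α).choose (u - α) * (u - α).factorial * (m - u).factorial =
      (m - α).factorial := by
    have := Nat.choose_mul_factorial_mul_factorial (n := m - α) (k := u - α) (by omega)
    rwa [show m - α - (u - α) = m - u by omega] at this
  have p1 := Nat.factorial_pos (n - 2 * T)
  have p2 := Nat.factorial_pos (m - u)
  apply Nat.eq_of_mul_eq_mul_left (Nat.mul_pos p1 p2)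
  rw [hr]
  calc _ = ((n - 2 * T).factorial * (n - m).descFactorial (2 * T - m)) *
        ((n - u).choose (m - u) * (m - u).factorial) * (m - α).factorial *
        (r ^ (2 * T - m) * r ^ (m - α)) := by ring
    _ = ((n - u).choose (m - u) * (m - u).factorial * (n - m).factorial) * (m - α).factorial *
        (r ^ (2 * T - m) * r ^ (m - α)) := by rw [h1]; ring
    _ = ((n - 2 * T).factorial * (n - u).descFactorial (2 * T - u)) *
        ((m - α).choose (u - α) * (u - α).factorial * (m - u).factorial) *
        (r ^ (2 * T - m) * r ^ (m - α)) := by rw [h3, h2, h4]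
    _ = _ := by ring

lemma arith2 (n T u α r : ℕ) (hT : 2 * T ≤ n) (hα : α ≤ T)
    (hαu : α ≤ u) (hu : u ≤ 2 * α) :
    (r ^ (2 * T - α) * (n - u).descFactorial (2 * T - u) * (u - α).factorial) *
      (n - α).choose (u - α) * (r ^ n * n.factorial) =
    (n.descFactorial (2 * T) * r ^ (2 * T)) * (r ^ (n - α) * (n - α).factorial) := by
  have hr : r ^ (2 * T - α) * r ^ n = r ^ (2 * T) * r ^ (n - α) := by
    rw [← pow_add, ← pow_add]; congr 1; omega
  have h1 : (n - 2 * T).factorial * n.descFactorial (2 * T) = n.factorial :=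
    Nat.factorial_mul_descFactorial hT
  have h2 : (n - 2 * T).factorial * (n - u).descFactorial (2 * T - u) = (n - u).factorial := by
    have := Nat.factorial_mul_descFactorial (n := n - u) (k := 2 * T - u) (by omega)
    rwa [show n - u - (2 * T - u) = n - 2 * T by omega] at this
  have h4 : (n - α).choose (u - α) * (u - α).factorial * (n - u).factorial =
      (n - α).factorial := by
    have := Nat.choose_mul_factorial_mul_factorial (n := n - α) (k := u - α) (by omega)
    rwa [show n - α - (u - α) = n - u by omega] at this
  apply Nat.eq_of_mul_eq_mul_left (Nat.factorial_pos (n - 2 * T))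
  calc _ = ((n - 2 * T).factorial * (n - u).descFactorial (2 * T - u)) * (u - α).factorial *
        (n - α).choose (u - α) * n.factorial * (r ^ (2 * T - α) * r ^ n) := by ring
    _ = ((n - α).choose (u - α) * (u - α).factorial * (n - u).factorial) * n.factorial *
        (r ^ (2 * T - α) * r ^ n) := by rw [h2]; ring
    _ = ((n - 2 * T).factorial * n.descFactorial (2 * T)) * (n - α).factorial *
        (r ^ (2 * T) * r ^ (n - α)) := by rw [h4, hr, h1]; ring
    _ = _ := by ring

variable {G : Type*} [CommGroup G] {n : ℕ} [Fintype G]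

open Classical in
/-- the signed measure -/
noncomputable def nu (T : ℕ) (c : ℕ → ℤ) (w : Wr G n) : ℤ :=
  ∑ j ∈ Finset.range (T + 1), c j * (((n - (T + j)).descFactorial (2 * T - (T + j)) *
    Fintype.card G ^ (2 * T - (T + j)) : ℕ) *
    (((Finset.powersetCard (T + j) (Finset.univ : Finset (Fin n))).filter
      fun X => sup w ⊆ X).card : ℤ))

open Classical in
lemma nu_base (T : ℕ) (hT : 2 * T ≤ n) (c : ℕ → ℤ)
    (hc : ∀ s d : ℕ, d ≤ T → ((s + (n - T)).choose d : ℤ) =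
      ∑ j ∈ Finset.range (T + 1), c j * ((s + j).choose d : ℤ))
    (A : Finset (Fin n)) (w0 : Wr G n) (hA : ∀ x ∈ A, ¬ Fx w0 x) (hAT : A.card ≤ T) :
    (∑ w ∈ ev A w0, nu T c w) * (Fintype.card (Wr G n) : ℤ) =
      ((n.descFactorial (2 * T) * Fintype.card G ^ (2 * T) : ℕ) : ℤ) * ((ev A w0).card : ℤ) := by
  set U := A ∪ A.image w0.right with hU
  set r := Fintype.card G
  have hαu : A.card ≤ U.card := Finset.card_le_card Finset.subset_union_left
  have huα : U.card ≤ 2 * A.card := by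
    refine (Finset.card_union_le _ _).trans ?_
    have := Finset.card_image_le (s := A) (f := w0.right)
    refine (Nat.add_le_add_left this _).trans (by omega)
  have hcnt : ∀ m, ∑ w ∈ ev A w0, ((Finset.powersetCard m (Finset.univ : Finset (Fin n))).filter
      fun X => sup w ⊆ X).card =
      ((Finset.powersetCard m (Finset.univ : Finset (Fin n))).filter fun X => U ⊆ X).card *
        (r ^ (m - A.card) * (m - A.card).factorial) := by
    intro m
    simp_rw [Finset.card_filter]
    rw [Finset.sum_comm, Finset.sum_mul]
    refine Finset.sum_congr rfl fun X hX => ?_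
    rw [← Finset.card_filter, card_evX A X w0 hA, (Finset.mem_powersetCard.1 hX).2, ite_mul,
      one_mul, zero_mul]
  have hm : ∀ j ∈ Finset.range (T + 1),
      ((n - (T + j)).descFactorial (2 * T - (T + j)) * r ^ (2 * T - (T + j))) *
      (∑ w ∈ ev A w0, ((Finset.powersetCard (T + j) (Finset.univ : Finset (Fin n))).filter
      fun X => sup w ⊆ X).card) =
      (r ^ (2 * T - A.card) * (n - U.card).descFactorial (2 * T - U.card) *
        (U.card - A.card).factorial) * ((T - A.card) + j).choose (U.card - A.card) := by
    intro j hj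
    have hj' : j ≤ T := by simpa [Nat.lt_succ_iff] using hj
    rw [hcnt, show T - A.card + j = T + j - A.card by omega]
    rcases le_or_gt U.card (T + j) with h | h
    · rw [card_super U _ h]
      exact arith1 n T (T + j) U.card A.card r hT (by omega) (by omega) hAT hαu h
    · rw [card_super_zero U _ h, Nat.choose_eq_zero_of_lt (n := T + j - A.card) (by omega)]
      simp
  have hsum : ∑ w ∈ ev A w0, nu T c w =
      ((r ^ (2 * T - A.card) * (n - U.card).descFactorial (2 * T - U.card) *
        (U.card - A.card).factorial) * (n - A.card).choose (U.card - A.card) : ℕ) := by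
    unfold nu
    rw [Finset.sum_comm]
    simp_rw [← Finset.mul_sum]
    have : ∀ j ∈ Finset.range (T + 1), _ = _ := fun j hj => congrArg (Nat.cast : ℕ → ℤ) (hm j hj)
    push_cast at this
    push_cast
    rw [Finset.sum_congr rfl fun j hj => congrArg (c j * ·) (this j hj)]
    have h2 := hc (T - A.card) (U.card - A.card) (by omega)
    rw [show T - A.card + (n - T) = n - A.card by omega] at h2
    rw [h2, Finset.mul_sum]
    refine Finset.sum_congr rfl fun j _ => ?_
    ring
  rw [hsum, card_ev, card_Wr]
  exact_mod_cast arith2 n T U.card A.card r hT hAT hαu huα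

lemma nu_ev (T : ℕ) (hT : 2 * T ≤ n) (c : ℕ → ℤ)
    (hc : ∀ s d : ℕ, d ≤ T → ((s + (n - T)).choose d : ℤ) =
      ∑ j ∈ Finset.range (T + 1), c j * ((s + j).choose d : ℤ)) (k : ℕ) :
    ∀ (A : Finset (Fin n)) (w0 : Wr G n), (A ∩ (sup w0)ᶜ).card = k → A.card ≤ T →
    (∑ w ∈ ev A w0, nu T c w) * (Fintype.card (Wr G n) : ℤ) =
      ((n.descFactorial (2 * T) * Fintype.card G ^ (2 * T) : ℕ) : ℤ) * ((ev A w0).card : ℤ) := by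
  classical
  induction k using Nat.strong_induction_on with
  | _ k ih =>
  intro A w0 hk hAT
  set Dd := n.descFactorial (2 * T) * Fintype.card G ^ (2 * T)
  by_cases hA : ∀ x ∈ A, ¬ Fx w0 x
  · exact nu_base T hT c hc A w0 hA hAT
  push Not at hA
  obtain ⟨x, hx, hfx⟩ := hA
  have hxm : x ∈ A ∩ (sup w0)ᶜ := by
    rw [Finset.mem_inter, Finset.mem_compl]
    exact ⟨hx, notMem_sup.2 hfx⟩
  set A' := A.erase x with hA'
  have hAA : A = insert x A' := (Finset.insert_erase hx).symm
  -- reformulate as vanishing sums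
  let φ : Wr G n → ℤ := fun w => nu T c w * (Fintype.card (Wr G n) : ℤ) - Dd
  have hφ : ∀ (A : Finset (Fin n)) (w0 : Wr G n), ∑ w ∈ ev A w0, φ w =
      (∑ w ∈ ev A w0, nu T c w) * (Fintype.card (Wr G n) : ℤ) - (Dd : ℤ) * ((ev A w0).card : ℤ) := by
    intro A w0
    simp only [φ]
    rw [Finset.sum_sub_distrib, Finset.sum_mul, Finset.sum_const, nsmul_eq_mul, mul_comm (Dd : ℤ)]
  have h1 : ∑ w ∈ ev A' w0, φ w = 0 := by
    rw [hφ, sub_eq_zero]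
    refine ih (A' ∩ (sup w0)ᶜ).card ?_ A' w0 rfl ((Finset.card_erase_le).trans hAT)
    rw [← hk]
    apply Finset.card_lt_card
    rw [hA', Finset.erase_inter]
    exact Finset.erase_ssubset hxm
  have h2 : ∀ p : Pt G n, p ≠ ⟨1, x⟩ →
      ∑ w ∈ (ev A' w0).filter (fun w => w • (⟨1, x⟩ : Pt G n) = p), φ w = 0 := by
    intro p hp
    by_cases hne : ((ev A' w0).filter (fun w => w • (⟨1, x⟩ : Pt G n) = p)).Nonempty
    · obtain ⟨w1, hw1⟩ := hne
      rw [Finset.mem_filter, mem_ev] at hw1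
      have hset : (ev A' w0).filter (fun w => w • (⟨1, x⟩ : Pt G n) = p) = ev A w1 := by
        ext w
        rw [Finset.mem_filter, mem_ev, mem_ev, hAA]
        simp only [Finset.mem_insert, forall_eq_or_imp]
        rw [hw1.2, and_comm]
        refine and_congr Iff.rfl (forall₂_congr fun y hy => ?_)
        rw [hw1.1 y hy]
      rw [hset, hφ, sub_eq_zero]
      refine ih (A ∩ (sup w1)ᶜ).card ?_ A w1 rfl hAT
      rw [← hk]
      apply Finset.card_lt_card
      rw [Finset.ssubset_iff_of_subset]
      · refine ⟨x, hxm, ?_⟩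
        rw [Finset.mem_inter, Finset.mem_compl]
        rintro ⟨_, h⟩
        rw [notMem_sup, Fx_iff, hw1.2] at h
        exact hp h
      · intro y hy
        rw [Finset.mem_inter, Finset.mem_compl, notMem_sup, Fx_iff] at hy ⊢
        refine ⟨hy.1, ?_⟩
        by_cases hyx : y = x
        · rw [hyx]; exact Fx_iff.1 hfx
        · rw [← hw1.1 y (Finset.mem_erase.2 ⟨hyx, hy.1⟩)]; exact hy.2
    · rw [Finset.not_nonempty_iff_eq_empty.1 hne, Finset.sum_empty]
  have h3 := Finset.sum_fiberwise (ev A' w0) (fun w => w • (⟨1, x⟩ : Pt G n)) φ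
  rw [h1, Finset.sum_eq_single (⟨1, x⟩ : Pt G n) (fun p _ hp => h2 p hp) (by simp)] at h3
  have hset : (ev A' w0).filter (fun w => w • (⟨1, x⟩ : Pt G n) = ⟨1, x⟩) = ev A w0 := by
    ext w
    rw [Finset.mem_filter, mem_ev, mem_ev, hAA]
    simp only [Finset.mem_insert, forall_eq_or_imp]
    rw [Fx_iff.1 hfx, and_comm]
  rw [hset, hφ, sub_eq_zero] at h3
  exact h3

/-- the identity needed for `Hyp` -/
lemma nu_ph {t : ℕ} (hT : 2 * (2 * t) ≤ n) (c : ℕ → ℤ)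
    (hc : ∀ s d : ℕ, d ≤ 2 * t → ((s + (n - 2 * t)).choose d : ℤ) =
      ∑ j ∈ Finset.range (2 * t + 1), c j * ((s + j).choose d : ℤ))
    (q q' : (Fin t → Pt G n) × (Fin t → Pt G n)) :
    ∑ x : Wr G n, (nu (2 * t) c x : ℚ) * (ph x q * ph x q') =
      (((n.descFactorial (2 * (2 * t)) * Fintype.card G ^ (2 * (2 * t)) : ℕ) : ℚ) /
        Fintype.card (Wr G n)) * ∑ x : Wr G n, ph x q * ph x q' := by
  classical
  by_cases h : ∃ w0 : Wr G n, w0 • q.1 = q.2 ∧ w0 • q'.1 = q'.2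
  · obtain ⟨w0, h1, h2⟩ := h
    set A : Finset (Fin n) := (Finset.univ.image fun i => (q.1 i).2) ∪
      (Finset.univ.image fun i => (q'.1 i).2) with hA
    have hAc : A.card ≤ 2 * t := by
      refine (Finset.card_union_le _ _).trans ?_
      have e1 := Finset.card_image_le (s := Finset.univ) (f := fun i => (q.1 i).2)
      have e2 := Finset.card_image_le (s := Finset.univ) (f := fun i => (q'.1 i).2)
      simp only [Finset.card_univ, Fintype.card_fin] at e1 e2
      omega
    have key : ∀ (w : Wr G n) (p : Pt G n), w • p = w0 • p ↔
        w • (⟨1, p.2⟩ : Pt G n) = w0 • (⟨1, p.2⟩ : Pt G n) := by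
      rintro w ⟨a, x⟩
      simp only [smul_pt, Pt.mk.injEq, one_mul, mul_right_inj]
    have hph : ∀ w : Wr G n, ph w q * ph w q' = if w ∈ ev A w0 then 1 else 0 := by
      intro w
      have hiff : w ∈ ev A w0 ↔ w • q.1 = q.2 ∧ w • q'.1 = q'.2 := by
        rw [mem_ev, ← h1, ← h2, funext_iff, funext_iff, hA]
        simp only [Finset.mem_union, Finset.mem_image, Finset.mem_univ, true_and, Pi.smul_apply]
        constructor
        · intro h
          exact ⟨fun i => (key w _).2 (h _ (Or.inl ⟨i, rfl⟩)),
            fun i => (key w _).2 (h _ (Or.inr ⟨i, rfl⟩))⟩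
        · rintro ⟨h1, h2⟩ x (⟨i, rfl⟩ | ⟨i, rfl⟩)
          · exact (key w _).1 (h1 i)
          · exact (key w _).1 (h2 i)
      simp only [hiff, ph]
      by_cases e1 : w • q.1 = q.2 <;> by_cases e2 : w • q'.1 = q'.2 <;> simp [e1, e2]
    simp_rw [hph]
    simp only [mul_ite, mul_one, mul_zero, Finset.sum_ite_mem, Finset.univ_inter,
      Finset.sum_const, nsmul_eq_mul]
    have := nu_ev (G := G) (2 * t) hT c hc _ A w0 rfl hAc
    have hW : (0 : ℚ) < Fintype.card (Wr G n) := by exact_mod_cast Fintype.card_pos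
    rw [div_mul_eq_mul_div, eq_div_iff hW.ne']
    exact_mod_cast this
  · have hph : ∀ w : Wr G n, ph w q * ph w q' = 0 := by
      intro w
      simp only [ph]
      by_cases e1 : w • q.1 = q.2 <;> by_cases e2 : w • q'.1 = q'.2 <;> simp [e1, e2]
      exact h ⟨w, e1, e2⟩
    simp [hph]

end Nu2
end SD

namespace SD
section Fin1

variable {G : Type*} [CommGroup G] {n : ℕ} [Fintype G]

lemma sum_ph_card {W Ω : Type*} [Group W] [MulAction W Ω] (s : Finset W) (q : Ω × Ω)
    [DecidablePred fun y : W => y • q.1 = q.2] :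
    ∑ y ∈ s, ph y q = ((s.filter fun y => y • q.1 = q.2).card : ℚ) := by
  rw [← Finset.sum_boole]
  refine Finset.sum_congr rfl fun y _ => ?_
  unfold ph
  split_ifs <;> rfl

lemma card_Pt : Fintype.card (Pt G n) = Fintype.card G * n := by
  rw [← Fintype.card_congr (ptEquiv G n)]; simp

lemma hyp_B (k : ℕ) (hk : k ≤ n) :
    ∃ B : Finset (Wr G n), (∀ w, w ∈ B ↔ (sup w).card ≤ k) ∧
      B.card ≤ (Fintype.card G * n) ^ k := by
  classical
  refine ⟨Finset.univ.filter fun w => (sup w).card ≤ k, by simp, ?_⟩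
  have hsub : (Finset.univ.filter fun w : Wr G n => (sup w).card ≤ k) ⊆
      (Finset.powersetCard k (Finset.univ : Finset (Fin n))).biUnion
        fun X => ev Xᶜ (1 : Wr G n) := by
    intro w hw
    rw [Finset.mem_filter] at hw
    obtain ⟨X, hX, hXc⟩ := Finset.exists_superset_card_eq (s := sup w) (n := k) hw.2 (by simpa)
    rw [Finset.mem_biUnion]
    refine ⟨X, by simp [Finset.mem_powersetCard, hXc], ?_⟩
    rw [mem_ev]
    intro x hx
    rw [one_smul, ← Fx_iff, ← notMem_sup]
    exact fun h => (Finset.mem_compl.1 hx) (hX h)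
  refine (Finset.card_le_card hsub).trans ?_
  refine (Finset.card_biUnion_le_card_mul _ _ (Fintype.card G ^ k * k.factorial) ?_).trans ?_
  · intro X hX
    have h2 := (Finset.mem_powersetCard.1 hX).2
    rw [card_ev, Finset.card_compl, Fintype.card_fin, h2, Nat.sub_sub_self hk]
  · rw [Finset.card_powersetCard, Finset.card_univ, Fintype.card_fin, mul_pow]
    have := Nat.descFactorial_le_pow n k
    rw [Nat.descFactorial_eq_factorial_mul_choose] at this
    calc n.choose k * (Fintype.card G ^ k * k.factorial) =
        Fintype.card G ^ k * (k.factorial * n.choose k) := by ring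
      _ ≤ _ := Nat.mul_le_mul_left _ this

lemma nu_zero (T : ℕ) (c : ℕ → ℤ) (w : Wr G n) (h : 2 * T < (sup w).card) : nu T c w = 0 := by
  classical
  unfold nu
  refine Finset.sum_eq_zero fun j hj => ?_
  have hj' : j ≤ T := by simpa [Nat.lt_succ_iff] using hj
  rw [card_super_zero _ _ (by omega)]
  simp

lemma nu_bound (t : ℕ) (ht : 1 ≤ t) (hn : 5 * t ≤ n) (hr : 2 ≤ Fintype.card G) (c : ℕ → ℤ)
    (hc : ∀ j, |c j| ≤ (((2 * t : ℕ) : ℤ) + 1) * (2 * (n : ℤ)) ^ (2 * t)) (w : Wr G n) :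
    |nu (2 * t) c w| ≤ (((Fintype.card G * n) ^ (14 * t) : ℕ) : ℤ) := by
  classical
  set r := Fintype.card G
  set q := r * n with hq
  have hn1 : 1 ≤ n := by omega
  have hnq : n ≤ q := Nat.le_mul_of_pos_left n (by omega)
  have h2n : 2 * n ≤ q := Nat.mul_le_mul_right n hr
  have hq1 : 1 ≤ q := by omega
  have ht1 : 2 * t + 1 ≤ q ^ t := by
    calc 2 * t + 1 ≤ n := by omega
      _ ≤ q := hnq
      _ ≤ q ^ t := Nat.le_self_pow (by omega) q
  have hcn : ∀ j, |c j| ≤ ((q ^ (3 * t) : ℕ) : ℤ) := by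
    intro j
    refine (hc j).trans ?_
    have : (2 * t + 1) * (2 * n) ^ (2 * t) ≤ q ^ (3 * t) := by
      calc _ ≤ q ^ t * q ^ (2 * t) := Nat.mul_le_mul ht1 (Nat.pow_le_pow_left h2n _)
        _ = _ := by rw [← pow_add]; congr 1; omega
    exact_mod_cast this
  unfold nu
  refine (Finset.abs_sum_le_sum_abs _ _).trans ?_
  have hterm : ∀ j ∈ Finset.range (2 * t + 1),
      |c j * (((n - (2 * t + j)).descFactorial (2 * (2 * t) - (2 * t + j)) *
    r ^ (2 * (2 * t) - (2 * t + j)) : ℕ) *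
    (((Finset.powersetCard (2 * t + j) (Finset.univ : Finset (Fin n))).filter
      fun X => sup w ⊆ X).card : ℤ))| ≤ ((q ^ (9 * t) : ℕ) : ℤ) := by
    intro j hj
    have hj' : j ≤ 2 * t := by simpa [Nat.lt_succ_iff] using hj
    rw [abs_mul]
    have e1 : (n - (2 * t + j)).descFactorial (2 * (2 * t) - (2 * t + j)) *
        r ^ (2 * (2 * t) - (2 * t + j)) ≤ q ^ (2 * t) := by
      calc _ ≤ n ^ (2 * (2 * t) - (2 * t + j)) * r ^ (2 * (2 * t) - (2 * t + j)) := by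
            refine Nat.mul_le_mul_right _ ((Nat.descFactorial_le_pow _ _).trans
              (Nat.pow_le_pow_left (by omega) _))
        _ = q ^ (2 * (2 * t) - (2 * t + j)) := by rw [← mul_pow, mul_comm n]
        _ ≤ _ := Nat.pow_le_pow_right hq1 (by omega)
    have e2 : ((Finset.powersetCard (2 * t + j) (Finset.univ : Finset (Fin n))).filter
      fun X => sup w ⊆ X).card ≤ q ^ (4 * t) := by
      refine (Finset.card_filter_le _ _).trans ?_
      rw [Finset.card_powersetCard, Finset.card_univ, Fintype.card_fin]
      calc _ ≤ n ^ (2 * t + j) := Nat.choose_le_pow _ _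
        _ ≤ q ^ (2 * t + j) := Nat.pow_le_pow_left hnq _
        _ ≤ _ := Nat.pow_le_pow_right hq1 (by omega)
    have e3 := Nat.mul_le_mul e1 e2
    rw [← Nat.cast_mul, Nat.abs_cast]
    have e4 : ((q ^ (9 * t) : ℕ) : ℤ) =
        ((q ^ (3 * t) : ℕ) : ℤ) * ((q ^ (2 * t) * q ^ (4 * t) : ℕ) : ℤ) := by
      rw [← Nat.cast_mul]; congr 1; rw [← pow_add, ← pow_add]; congr 1; omega
    rw [e4]
    exact mul_le_mul (hcn j) (by exact_mod_cast e3) (by positivity) (by positivity)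
  refine (Finset.sum_le_sum hterm).trans ?_
  rw [Finset.sum_const, Finset.card_range, nsmul_eq_mul, ← Nat.cast_mul]
  have : (2 * t + 1) * q ^ (9 * t) ≤ q ^ (14 * t) := by
    calc _ ≤ q ^ t * q ^ (9 * t) := Nat.mul_le_mul_right _ ht1
      _ = q ^ (10 * t) := by rw [← pow_add]; congr 1; omega
      _ ≤ _ := Nat.pow_le_pow_right hq1 (by omega)
  exact_mod_cast this

lemma exists_hyp (t : ℕ) (ht : 1 ≤ t) (hn : 5 * t ≤ n) (hr : 2 ≤ Fintype.card G) :
    ∃ (B : Finset (Wr G n)) (ν : Wr G n → ℤ) (D : ℕ),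
      Hyp (Fin t → Pt G n) B ν D ((Fintype.card G * n) ^ (14 * t)) := by
  have hn1 : 1 ≤ n := by omega
  have h2n : 2 * n ≤ Fintype.card G * n := Nat.mul_le_mul_right n hr
  have hq1 : 1 ≤ Fintype.card G * n := by omega
  obtain ⟨B, hB, hBc⟩ := hyp_B (G := G) (n := n) (5 * t) hn
  obtain ⟨c, hc1, hc2⟩ := extrap (2 * t) (n - 2 * t) n (by omega) hn1
  refine ⟨B, nu (2 * t) c, n.descFactorial (2 * (2 * t)) * Fintype.card G ^ (2 * (2 * t)), ?_⟩
  refine ⟨?_, ?_, ?_, ?_, ?_, ?_, ?_, ?_, ?_⟩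
  · refine Nat.mul_pos ?_ (pow_pos (by omega) _)
    exact Nat.descFactorial_pos.2 (by omega)
  · calc 2 ≤ Fintype.card G * n := by omega
      _ ≤ _ := Nat.le_self_pow (by omega) _
  · exact hBc.trans (Nat.pow_le_pow_right hq1 (by omega))
  · calc _ ≤ n ^ (2 * (2 * t)) * Fintype.card G ^ (2 * (2 * t)) :=
          Nat.mul_le_mul_right _ (Nat.descFactorial_le_pow _ _)
      _ = (Fintype.card G * n) ^ (2 * (2 * t)) := by rw [← mul_pow, mul_comm n]
      _ ≤ _ := Nat.pow_le_pow_right hq1 (by omega)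
  · exact nu_bound t ht hn hr c hc1
  · intro x hx
    rw [hB] at hx
    exact nu_zero _ _ _ (by omega)
  · rw [Fintype.card_fun, card_Pt, Fintype.card_fin, ← pow_mul]
    exact Nat.pow_le_pow_right hq1 (by omega)
  · exact fun g => A0 ht B (fun w hw => (hB w).2 hw) g
  · exact nu_ph (by omega) c hc2

lemma pow_le_fac_sq (n : ℕ) : n ^ n ≤ n.factorial ^ 2 := by
  have h1 : n.factorial ^ 2 = ∏ i ∈ Finset.range n, ((i + 1) * (n - 1 - i + 1)) := by
    rw [Finset.prod_mul_distrib, Finset.prod_range_add_one_eq_factorial,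
      Finset.prod_range_reflect (fun i => i + 1) n, Finset.prod_range_add_one_eq_factorial, sq]
  rw [h1]
  calc n ^ n = ∏ i ∈ Finset.range n, n := by simp
    _ ≤ _ := Finset.prod_le_prod' fun i hi => ?_
  have hi := Finset.mem_range.1 hi
  obtain ⟨k, rfl⟩ : ∃ k, n = i + 1 + k := ⟨n - 1 - i, by omega⟩
  rw [show i + 1 + k - 1 - i = k by omega]
  nlinarith

lemma exists_Y (t : ℕ) (ht : 1 ≤ t) (hr : 2 ≤ Fintype.card G) (hn1 : 1 ≤ n) :
    ∃ (Y : Finset (Wr G n)) (M : ℕ), 0 < M ∧ M ≤ (Fintype.card G * n) ^ (1120 * t) ∧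
      ∀ q : (Fin t → Pt G n) × (Fin t → Pt G n),
        ∑ y ∈ Y, ph y q = (M / Fintype.card (Wr G n) : ℚ) * ∑ x : Wr G n, ph x q := by
  set r := Fintype.card G with hrr
  have hq1 : 1 ≤ r * n := Nat.mul_pos (by omega) hn1
  by_cases hn : 1120 * t ≤ n
  · obtain ⟨B, ν, D, h⟩ := exists_hyp (G := G) (n := n) t ht (by omega) hr
    have hW : ((r * n) ^ (14 * t)) ^ 40 ≤ Fintype.card (Wr G n) := by
      rw [card_Wr, ← hrr]
      have : (((r * n) ^ (14 * t)) ^ 40) ^ 2 ≤ (r ^ n * n.factorial) ^ 2 := by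
        calc (((r * n) ^ (14 * t)) ^ 40) ^ 2 = (r * n) ^ (1120 * t) := by
              rw [← pow_mul, ← pow_mul]; congr 1; ring
          _ ≤ (r * n) ^ n := Nat.pow_le_pow_right hq1 hn
          _ = r ^ n * n ^ n := mul_pow _ _ _
          _ ≤ (r ^ n) ^ 2 * n.factorial ^ 2 :=
              Nat.mul_le_mul (Nat.le_self_pow (by norm_num) _) (pow_le_fac_sq n)
          _ = _ := (mul_pow _ _ _).symm
      exact (Nat.pow_le_pow_iff_left (by norm_num)).1 this
    obtain ⟨Y, M, hM, hMR, hY⟩ := main_abstract h hW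
    refine ⟨Y, M, hM, hMR.trans ?_, hY⟩
    rw [← pow_mul]
    exact Nat.pow_le_pow_right hq1 (by omega)
  · refine ⟨Finset.univ, Fintype.card (Wr G n), Fintype.card_pos, ?_, ?_⟩
    · rw [card_Wr]
      calc _ ≤ r ^ n * n ^ n := Nat.mul_le_mul_left _ (Nat.factorial_le_pow n)
        _ = (r * n) ^ n := (mul_pow _ _ _).symm
        _ ≤ _ := Nat.pow_le_pow_right hq1 (by omega)
    · intro q
      have hW : (Fintype.card (Wr G n) : ℚ) ≠ 0 := by exact_mod_cast Fintype.card_pos.ne'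
      rw [div_self hW, one_mul]

lemma card_of {t : ℕ} (Y : Finset (Wr G n)) (M : ℕ) (hn1 : 1 ≤ n)
    (hY : ∀ q : (Fin t → Pt G n) × (Fin t → Pt G n),
        ∑ y ∈ Y, ph y q = (M / Fintype.card (Wr G n) : ℚ) * ∑ x : Wr G n, ph x q) :
    Y.card = M := by
  classical
  let a : Fin t → Pt G n := fun _ => ⟨1, ⟨0, hn1⟩⟩
  have hsum : ∀ y : Wr G n, ∑ b, ph y (a, b) = 1 := by
    intro y
    rw [Finset.sum_eq_single (y • a)]
    · simp [ph]
    · intro b _ hb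
      simp only [ph]
      exact if_neg fun h => hb h.symm
    · simp
  have h : ∑ b, ∑ y ∈ Y, ph y (a, b) =
      ∑ b, (M / Fintype.card (Wr G n) : ℚ) * ∑ x : Wr G n, ph x (a, b) :=
    Finset.sum_congr rfl fun b _ => hY (a, b)
  rw [← Finset.mul_sum, Finset.sum_comm,
    Finset.sum_comm (f := fun (b : Fin t → Pt G n) (x : Wr G n) => ph x (a, b)),
    Finset.sum_congr rfl fun y _ => hsum y, Finset.sum_congr rfl fun y _ => hsum y] at h
  have hW : (Fintype.card (Wr G n) : ℚ) ≠ 0 := by exact_mod_cast Fintype.card_pos.ne'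
  simp only [Finset.sum_const, nsmul_eq_mul, mul_one, Finset.card_univ] at h
  rw [div_mul_cancel₀ _ hW] at h
  exact_mod_cast h

lemma exists_w0 {t : ℕ} (a b : Fin t → Pt G n) (ha : Function.Injective fun i => (a i).2)
    (hb : Function.Injective fun i => (b i).2) : ∃ w0 : Wr G n, w0 • a = b := by
  obtain ⟨π, hπ⟩ := (Equiv.Perm.isMultiplyPretransitive (Fin n) t).exists_smul_eq
    (⟨_, ha⟩ : Fin t ↪ Fin n) ⟨_, hb⟩
  have hπ' : ∀ i, π (a i).2 = (b i).2 := fun i => DFunLike.congr_fun hπ i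
  refine ⟨⟨Function.extend (fun i => (b i).2) (fun i => (a i).1⁻¹ * (b i).1) 1, π⟩, ?_⟩
  funext i
  change (_ : Wr G n) • (⟨(a i).1, (a i).2⟩ : Pt G n) = _
  rw [smul_pt]
  simp only
  rw [hπ', hb.extend_apply]
  ext <;> simp

lemma sum_ph {t : ℕ} (a b : Fin t → Pt G n) (ha : Function.Injective fun i => (a i).2)
    (hb : Function.Injective fun i => (b i).2) : ∑ x : Wr G n, ph x (a, b) =
      ((Fintype.card G ^ (n - t) * (n - t).factorial : ℕ) : ℚ) := by
  classical
  obtain ⟨w0, h0⟩ := exists_w0 a b ha hb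
  have hA : (Finset.univ.image fun i => (a i).2).card = t := by
    rw [Finset.card_image_of_injective _ ha]; simp
  have := card_ev (Finset.univ.image fun i => (a i).2) w0
  rw [hA] at this
  rw [← this]
  rw [sum_ph_card]
  congr 2
  ext w
  rw [Finset.mem_filter, mem_ev, ← h0, funext_iff]
  simp only [Finset.mem_univ, true_and, Finset.mem_image, Pi.smul_apply, forall_exists_index,
    forall_apply_eq_imp_iff]
  refine forall_congr' fun i => ?_
  change w • (⟨(a i).1, (a i).2⟩ : Pt G n) = w0 • (⟨(a i).1, (a i).2⟩ : Pt G n) ↔ _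
  simp only [smul_pt, Pt.mk.injEq, one_mul, mul_right_inj]

lemma trans_of {t : ℕ} (htn : t ≤ n) (Y : Finset (Wr G n)) (M : ℕ) (hM : 0 < M)
    (hY : ∀ q : (Fin t → Pt G n) × (Fin t → Pt G n),
        ∑ y ∈ Y, ph y q = (M / Fintype.card (Wr G n) : ℚ) * ∑ x : Wr G n, ph x q) :
    IsTransitiveOn (fun (w : Wr G n) v => fun s => wAct w (v s))
      {v : Fin t → G × Fin n | Function.Injective fun s => (v s).2} (Y : Set (Wr G n)) := by
  classical
  have key : ∀ a ∈ {v : Fin t → G × Fin n | Function.Injective fun s => (v s).2},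
      ∀ b ∈ {v : Fin t → G × Fin n | Function.Injective fun s => (v s).2},
      (Nat.card {y : Wr G n // y ∈ (Y : Set (Wr G n)) ∧ (fun s => wAct y (a s)) = b} : ℚ) =
      (M / Fintype.card (Wr G n) : ℚ) *
        ((Fintype.card G ^ (n - t) * (n - t).factorial : ℕ) : ℚ) := by
    intro a ha b hb
    have h := hY (fun i => ptEquiv G n (a i), fun i => ptEquiv G n (b i))
    rw [sum_ph (fun i => ptEquiv G n (a i)) (fun i => ptEquiv G n (b i)) ha hb] at h
    rw [← h]
    rw [sum_ph_card, Nat.card_eq_fintype_card, Fintype.card_subtype]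
    congr 2
    ext y
    simp only [Finset.mem_filter, Finset.mem_univ, true_and, Finset.mem_coe]
    refine and_congr Iff.rfl ?_
    rw [funext_iff, funext_iff]
    refine forall_congr' fun i => ?_
    change _ ↔ ptEquiv G n (wAct y (a i)) = ptEquiv G n (b i)
    rw [EmbeddingLike.apply_eq_iff_eq]
  have h0 : (fun i : Fin t => ((1 : G), Fin.castLE htn i)) ∈
      {v : Fin t → G × Fin n | Function.Injective fun s => (v s).2} :=
    Fin.castLE_injective htn
  refine ⟨Nat.card {y : Wr G n // y ∈ (Y : Set (Wr G n)) ∧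
      (fun s => wAct y ((fun i : Fin t => ((1 : G), Fin.castLE htn i)) s)) =
        (fun i : Fin t => ((1 : G), Fin.castLE htn i))}, ?_, fun a ha b hb => ?_⟩
  · have := key _ h0 _ h0
    have hW : (0 : ℚ) < Fintype.card (Wr G n) := by exact_mod_cast Fintype.card_pos
    have hG : 0 < Fintype.card G := Fintype.card_pos
    have hp : (0 : ℚ) < (M / Fintype.card (Wr G n) : ℚ) *
        ((Fintype.card G ^ (n - t) * (n - t).factorial : ℕ) : ℚ) := by
      refine mul_pos (div_pos (by exact_mod_cast hM) hW) ?_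
      exact_mod_cast Nat.mul_pos (pow_pos hG _) (Nat.factorial_pos _)
    rw [← this] at hp
    exact_mod_cast hp
  · have := (key a ha b hb).trans (key _ h0 _ h0).symm
    exact_mod_cast this

end Fin1
end SD

/-- **Existence of small `t`-designs in `C_r ≀ Sₙ`.**
There is a universal constant `c > 0` such that for all integers `r ≥ 2`, `n ≥ 1` and
`1 ≤ t ≤ n`, there exists a `t`-design `Y` in `C_r ≀ Sₙ` with `|Y| ≤ (c·r·n)^(c·t)`. -/
theorem existence_small_designs :
    ∃ c : ℝ, 0 < c ∧ ∀ r n t : ℕ, 2 ≤ r → 1 ≤ n → 1 ≤ t → t ≤ n →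
      ∃ Y : Set (Wr (Multiplicative (ZMod r)) n),
        IsTDesign r n t Y ∧
        (Nat.card Y : ℝ) ≤ (c * r * n) ^ (c * t) := by
  refine ⟨1120, by norm_num, ?_⟩
  intro r n t hr hn ht htn
  haveI : NeZero r := ⟨by omega⟩
  have hc : Fintype.card (Multiplicative (ZMod r)) = r := by
    rw [Fintype.card_multiplicative, ZMod.card]
  obtain ⟨Y, M, hM, hMle, hY⟩ := SD.exists_Y (G := Multiplicative (ZMod r)) (n := n) t ht
    (by rw [hc]; exact hr) hn
  refine ⟨(Y : Set (Wr (Multiplicative (ZMod r)) n)), SD.trans_of htn Y M hM hY, ?_⟩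
  have h1 := SD.card_of Y M hn hY
  rw [hc] at hMle
  rw [Nat.card_coe_set_eq, Set.ncard_coe_finset, h1]
  have h2 : (M : ℝ) ≤ ((r : ℝ) * n) ^ (1120 * t) := by exact_mod_cast hMle
  refine h2.trans ?_
  have h3 : ((1120 : ℝ) * t) = ((1120 * t : ℕ) : ℝ) := by push_cast; ring
  rw [h3, Real.rpow_natCast]
  refine pow_le_pow_left₀ (by positivity) ?_ _
  have : (0 : ℝ) ≤ (r : ℝ) * n := by positivity
  nlinarith
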